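/- arXiv:1501.00692 — 3 statements merged into one kernel-verified Lean document; each statement's English description precedes it below -/
import Mathlib

section
/- Let K be a smooth function on R^d \ {0} of order ζ ∈ (-d,0), and let ρ_ε be a mollifier as above. Then for every ζ̄ ∈ [ζ-1, ζ) and every m ∈ N, there exists C > 0 such that ⦀K - K*ρ_ε⦀_{ζ̄;m} ≤ C ε^{ζ-ζ̄} ⦀K⦀_{ζ;m} for all ε ∈ (0,1]. -/
noncomputable section

open MeasureTheory Set ENNReal

/-- The norm `⦀K⦀_{ζ;m} = sup_{|k| ≤ m} sup_{x ≠ 0} |x|^{|k|-ζ} |D^k K(x)|`,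
valued in `ℝ≥0∞`. -/
def knorm {d : ℕ} (K : EuclideanSpace ℝ (Fin d) → ℝ) (ζ : ℝ) (m : ℕ) : ℝ≥0∞ :=
  ⨆ (k : Fin (m + 1)) (x : {x : EuclideanSpace ℝ (Fin d) // x ≠ 0}),
    ENNReal.ofReal (‖(x : EuclideanSpace ℝ (Fin d))‖ ^ (((k : ℕ) : ℝ) - ζ) *
      ‖iteratedFDeriv ℝ (k : ℕ) K (x : EuclideanSpace ℝ (Fin d))‖)

/-- The rescaled mollifier `ρ_ε(x) = ε^{-d} ρ(x/ε)`. -/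
def mollify {d : ℕ} (ρ : EuclideanSpace ℝ (Fin d) → ℝ) (ε : ℝ) :
    EuclideanSpace ℝ (Fin d) → ℝ :=
  fun x => ε ^ (-(d : ℤ)) * ρ (ε⁻¹ • x)

/-- Convolution `(K * L)(x) = ∫ K(x-y) L(y) dy`. -/
def convol {d : ℕ} (K L : EuclideanSpace ℝ (Fin d) → ℝ) :
    EuclideanSpace ℝ (Fin d) → ℝ :=
  fun x => ∫ y, K (x - y) * L y

section Auxiliary

open Metric Filter
open scoped Topology Convolution ContDiff

universe u

lemma sub_ne_zero_of_mem_closedBall {E : Type*} [SeminormedAddCommGroup E] {R : ℝ} {x y : E} (hx : R < ‖x‖) (hy : y ∈ closedBall (0 : E) R) :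
    x - y ≠ 0 := by
  rw [mem_closedBall_zero_iff] at hy
  intro h
  rw [sub_eq_zero.mp h] at hx
  linarith

lemma continuous_smul_comp_sub {E F : Type*} [NormedAddCommGroup E] [SeminormedAddCommGroup F]
    [NormedSpace ℝ F] {ρ : E → ℝ} {R : ℝ} (hρ : Continuous ρ) (hR : tsupport ρ ⊆ closedBall 0 R)
    {G : E → F} (hG : ContinuousOn G {x | x ≠ 0}) {x : E}
    (hx : R < ‖x‖) :
    Continuous fun y => ρ y • G (x - y) := by
  refine continuous_of_tsupport fun y hy => hρ.continuousAt.smul ?_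
  have hne := sub_ne_zero_of_mem_closedBall hx (hR (tsupport_smul_subset_left ρ _ hy))
  exact ContinuousAt.comp (f := fun y => x - y) (hG.continuousAt (isOpen_ne.mem_nhds hne))
    (by fun_prop)

variable {E F : Type u} [NormedAddCommGroup E] [NormedSpace ℝ E]
  [NormedAddCommGroup F] [NormedSpace ℝ F]

/-- No differentiability is needed: both sides rescale the same junk values. -/
lemma norm_iteratedFDeriv_comp_smul (k : ℕ) (f : E → F) (c : ℝ) (x : E) :
    ‖iteratedFDeriv ℝ k (fun z => f (c • z)) x‖ =
      |c| ^ k * ‖iteratedFDeriv ℝ k f (c • x)‖ := by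
  suffices H : ∀ (k : ℕ) (G : Type u) [NormedAddCommGroup G] [NormedSpace ℝ G]
      (f : E → G) (b : ℝ), ‖iteratedFDeriv ℝ k (b • fun z => f (c • z)) x‖ =
        |b| * |c| ^ k * ‖iteratedFDeriv ℝ k f (c • x)‖ by
    simpa using H k F f 1
  intro k
  induction k with
  | zero => intro G _ _ f b; simp [norm_smul]
  | succ k ih =>
    intro G _ _ f b
    have h : fderiv ℝ (b • fun z => f (c • z)) = (b * c) • fun z => fderiv ℝ f (c • z) := by
      ext1 z
      rw [fderiv_const_smul_field]
      simp only [Pi.smul_apply]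
      rw [fderiv_comp_smul, smul_smul]
    rw [← norm_iteratedFDeriv_fderiv, h, ih, norm_iteratedFDeriv_fderiv, abs_mul]
    ring

variable [MeasurableSpace E] [BorelSpace E] [FiniteDimensional ℝ E]

lemma hasFDerivAt_convolution_lsmul {μ : Measure E} [μ.IsAddHaarMeasure] {f : E → ℝ}
    (hf : LocallyIntegrable f μ) {g : E → F} (hg : ContDiff ℝ 1 g) (hgc : HasCompactSupport g)
    (x : E) :
    HasFDerivAt (f ⋆[ContinuousLinearMap.lsmul ℝ ℝ, μ] g)
      ((f ⋆[ContinuousLinearMap.lsmul ℝ ℝ, μ] fderiv ℝ g) x) x := by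
  have h := hgc.hasFDerivAt_convolution_right (ContinuousLinearMap.lsmul ℝ ℝ) hf hg x
  have hL : ContinuousLinearMap.precompR E (ContinuousLinearMap.lsmul ℝ ℝ : ℝ →L[ℝ] F →L[ℝ] F) =
      ContinuousLinearMap.lsmul ℝ ℝ := by
    ext; simp
  rwa [hL] at h

lemma norm_iteratedFDeriv_convolution_le {μ : Measure E} [μ.IsAddHaarMeasure] {f : E → ℝ}
    (hf : LocallyIntegrable f μ) (k : ℕ) {g : E → F} (hg : ContDiff ℝ ∞ g) {R : ℝ}
    (hgR : tsupport g ⊆ closedBall 0 R) {B : ℝ} (hB : ∀ y, ‖iteratedFDeriv ℝ k g y‖ ≤ B) (x : E) :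
    ‖iteratedFDeriv ℝ k (f ⋆[ContinuousLinearMap.lsmul ℝ ℝ, μ] g) x‖ ≤
      B * ∫ t in closedBall x R, ‖f t‖ ∂μ := by
  induction k generalizing F with
  | zero =>
    simp only [norm_iteratedFDeriv_zero] at hB ⊢
    have hint : IntegrableOn (fun t => ‖f t‖) (closedBall x R) μ :=
      (hf.integrableOn_isCompact (isCompact_closedBall x R)).norm
    rw [← integral_const_mul, ← integral_indicator measurableSet_closedBall]
    refine norm_integral_le_of_norm_le
      (IntegrableOn.integrable_indicator (hint.const_mul B) measurableSet_closedBall)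
      (Eventually.of_forall fun t => ?_)
    by_cases ht : t ∈ closedBall x R
    · rw [indicator_of_mem ht, ContinuousLinearMap.lsmul_apply, norm_smul, mul_comm]
      gcongr
      exact hB _
    · have : g (x - t) = 0 := by
        refine image_eq_zero_of_notMem_tsupport fun h => ht ?_
        have := hgR h
        rw [mem_closedBall_zero_iff] at this
        rwa [mem_closedBall, dist_comm, dist_eq_norm]
      simp [indicator_of_notMem ht, this]
  | succ k ih =>
    have hgc : HasCompactSupport g :=
      (isCompact_closedBall (0 : E) R).of_isClosed_subset (isClosed_tsupport g) hgR
    have h : fderiv ℝ (f ⋆[ContinuousLinearMap.lsmul ℝ ℝ, μ] g) =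
        f ⋆[ContinuousLinearMap.lsmul ℝ ℝ, μ] fderiv ℝ g :=
      funext fun y => (hasFDerivAt_convolution_lsmul hf (hg.of_le (by simp)) hgc y).fderiv
    rw [← norm_iteratedFDeriv_fderiv, h]
    refine ih (hg.fderiv_right (by simp)) ((tsupport_fderiv_subset ℝ).trans hgR) fun y => ?_
    rw [norm_iteratedFDeriv_fderiv]
    exact hB y

section AwayFromOrigin

variable {μ : Measure E} [μ.IsAddHaarMeasure] {ρ : E → ℝ} {R : ℝ}

lemma integrable_smul_comp_sub (hρ : Continuous ρ) (hR : tsupport ρ ⊆ closedBall 0 R) {G : E → F}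
    (hG : ContinuousOn G {x | x ≠ 0}) {x : E} (hx : R < ‖x‖) :
    Integrable (fun y => ρ y • G (x - y)) μ := by
  have hρc : HasCompactSupport ρ :=
    (isCompact_closedBall (0 : E) R).of_isClosed_subset (isClosed_tsupport ρ) hR
  exact (continuous_smul_comp_sub hρ hR hG hx).integrable_of_hasCompactSupport hρc.smul_right

lemma hasFDerivAt_integral_smul_comp_sub (hρ : Continuous ρ) (hR : tsupport ρ ⊆ closedBall 0 R)
    {G : E → F} (hG : ContDiffOn ℝ ∞ G {x | x ≠ 0}) {x : E} (hx : R < ‖x‖) :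
    HasFDerivAt (fun x => ∫ y, ρ y • G (x - y) ∂μ) (∫ y, ρ y • fderiv ℝ G (x - y) ∂μ) x := by
  have hopen : IsOpen {x : E | x ≠ 0} := isOpen_ne
  have hρc : HasCompactSupport ρ :=
    (isCompact_closedBall (0 : E) R).of_isClosed_subset (isClosed_tsupport ρ) hR
  have hG' : ContinuousOn (fderiv ℝ G) {x | x ≠ 0} :=
    (hG.fderiv_of_isOpen hopen (m := ∞) (by simp)).continuousOn
  obtain ⟨δ, hδ, hδx⟩ : ∃ δ > 0, R + 2 * δ = ‖x‖ := ⟨(‖x‖ - R) / 2, by linarith, by ring⟩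
  have hball : ∀ z ∈ ball x δ, R + δ < ‖z‖ := fun z hz => by
    rw [mem_ball, dist_eq_norm] at hz
    have := norm_sub_norm_le x z
    rw [norm_sub_rev] at this
    linarith
  have hZ : IsCompact (closedBall (0 : E) (‖x‖ + δ + R) \ ball 0 δ) :=
    (isCompact_closedBall _ _).diff isOpen_ball
  obtain ⟨B, hB⟩ := hZ.exists_bound_of_continuousOn (f := fderiv ℝ G) <| hG'.mono fun z hz h => by
    rw [h] at hz
    exact hz.2 (mem_ball_self hδ)
  refine hasFDerivAt_integral_of_dominated_of_fderiv_le (bound := fun y => ‖ρ y‖ * B)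
    (F' := fun x y => ρ y • fderiv ℝ G (x - y))
    (ball_mem_nhds x hδ) ?_ ?_ ?_ ?_ ?_ ?_
  · filter_upwards [ball_mem_nhds x hδ] with z hz
    exact (continuous_smul_comp_sub hρ hR hG.continuousOn
      (by linarith [hball z hz])).aestronglyMeasurable
  · exact integrable_smul_comp_sub hρ hR hG.continuousOn hx
  · exact (continuous_smul_comp_sub hρ hR hG' hx).aestronglyMeasurable
  · refine Eventually.of_forall fun y z hz => ?_
    by_cases hy : y ∈ tsupport ρ
    · rw [norm_smul]
      gcongr
      have hyR := hR hy
      rw [mem_closedBall_zero_iff] at hyR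
      have h1 := hball z hz
      rw [mem_ball, dist_eq_norm] at hz
      have h2 := norm_sub_norm_le z y
      have h3 := norm_sub_le z y
      have h4 := norm_sub_norm_le z x
      refine hB _ ⟨?_, ?_⟩
      · rw [mem_closedBall_zero_iff]; linarith
      · rw [mem_ball_zero_iff]; linarith
    · simp [image_eq_zero_of_notMem_tsupport hy]
  · exact (hρ.norm.integrable_of_hasCompactSupport hρc.norm).mul_const B
  · refine Eventually.of_forall fun y z hz => ?_
    by_cases hy : y ∈ tsupport ρ
    · have hne := sub_ne_zero_of_mem_closedBall (x := z) (by linarith [hball z hz]) (hR hy)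
      have hd : HasFDerivAt G (fderiv ℝ G (z - y)) (z - y) :=
        ((hG.contDiffAt (hopen.mem_nhds hne)).differentiableAt (by simp)).hasFDerivAt
      exact ((hasFDerivAt_comp_sub y).mpr hd).const_smul (ρ y)
    · simpa [image_eq_zero_of_notMem_tsupport hy] using hasFDerivAt_const (0 : F) z

lemma norm_iteratedFDeriv_sub_integral_le [CompleteSpace F] (hρ : Continuous ρ) (hR : tsupport ρ ⊆ closedBall 0 R)
    (hρi : ∫ y, ρ y ∂μ = 1) (k : ℕ) {G : E → F} (hG : ContDiffOn ℝ ∞ G {x | x ≠ 0}) {x : E}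
    (hx : R < ‖x‖) {B : ℝ} (hB : ∀ z ∈ closedBall x R, ‖iteratedFDeriv ℝ (k + 1) G z‖ ≤ B) :
    ‖iteratedFDeriv ℝ k (fun x => G x - ∫ y, ρ y • G (x - y) ∂μ) x‖ ≤
      (∫ y, ‖ρ y‖ ∂μ) * (B * R) := by
  have hopen : IsOpen {x : E | x ≠ 0} := isOpen_ne
  have hρc : HasCompactSupport ρ :=
    (isCompact_closedBall (0 : E) R).of_isClosed_subset (isClosed_tsupport ρ) hR
  have hdiff : ∀ z, z ≠ 0 → DifferentiableAt ℝ G z := fun z hz =>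
    (hG.contDiffAt (hopen.mem_nhds hz)).differentiableAt (by simp)
  have hsub : ∀ y ∈ closedBall (0 : E) R, x - y ∈ closedBall x R := fun y hy => by
    rw [mem_closedBall_zero_iff] at hy
    simpa [mem_closedBall, dist_eq_norm] using hy
  induction k generalizing F with
  | zero =>
    have hρint : Integrable ρ μ := hρ.integrable_of_hasCompactSupport hρc
    have hGx : G x = ∫ y, ρ y • G x ∂μ := by rw [integral_smul_const, hρi, one_smul]
    rw [norm_iteratedFDeriv_zero]
    nth_rw 1 [hGx]
    rw [← integral_sub (hρint.smul_const _) (integrable_smul_comp_sub hρ hR hG.continuousOn hx),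
      ← integral_mul_const]
    refine norm_integral_le_of_norm_le (hρint.norm.mul_const _) (Eventually.of_forall fun y => ?_)
    rw [← smul_sub, norm_smul]
    by_cases hy : y ∈ tsupport ρ
    · gcongr
      have hyR := hR hy
      have hR0 : 0 ≤ R := (norm_nonneg y).trans (mem_closedBall_zero_iff.mp hyR)
      have hfd : ∀ z ∈ closedBall x R, ‖fderiv ℝ G z‖ ≤ B := fun z hz => by
        simpa [← norm_iteratedFDeriv_fderiv] using hB z hz
      have hB0 : 0 ≤ B := (norm_nonneg _).trans (hfd x (mem_closedBall_self hR0))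
      refine ((convex_closedBall x R).norm_image_sub_le_of_norm_fderiv_le (𝕜 := ℝ)
        (fun z hz => hdiff z ?_) hfd (hsub y hyR) (mem_closedBall_self hR0)).trans ?_
      · rintro rfl
        rw [mem_closedBall, dist_eq_norm, zero_sub, norm_neg] at hz
        linarith
      · gcongr
        simpa using hyR
    · simp [image_eq_zero_of_notMem_tsupport hy]
  | succ k ih =>
    rw [← norm_iteratedFDeriv_fderiv]
    have hG' : ContDiffOn ℝ ∞ (fderiv ℝ G) {x | x ≠ 0} := hG.fderiv_of_isOpen hopen (by simp)
    have h0 : ∀ z : E, R < ‖z‖ → z ≠ 0 := by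
      rintro z hz rfl
      have hR0 : R < 0 := by simpa using hz
      have : ρ = 0 := funext fun y => image_eq_zero_of_notMem_tsupport fun hy => by
        linarith [norm_nonneg y, mem_closedBall_zero_iff.mp (hR hy)]
      simp [this] at hρi
    have h : fderiv ℝ (fun x => G x - ∫ y, ρ y • G (x - y) ∂μ) =ᶠ[𝓝 x]
        fun x => fderiv ℝ G x - ∫ y, ρ y • fderiv ℝ G (x - y) ∂μ := by
      filter_upwards [(isOpen_lt continuous_const continuous_norm).mem_nhds hx] with z hz
      exact ((hdiff z (h0 z hz)).hasFDerivAt.sub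
        (hasFDerivAt_integral_smul_comp_sub hρ hR hG hz)).fderiv
    rw [(h.iteratedFDeriv ℝ k).eq_of_nhds]
    refine ih hG' (fun z hz => ?_) fun z hz => ?_
    · rw [norm_iteratedFDeriv_fderiv]
      exact hB z hz
    · exact (hG'.contDiffAt (hopen.mem_nhds hz)).differentiableAt (by simp)

end AwayFromOrigin

section Kernel

variable {d : ℕ}

lemma convol_eq_convolution (K L : EuclideanSpace ℝ (Fin d) → ℝ) :
    convol K L = K ⋆[ContinuousLinearMap.lsmul ℝ ℝ] L := by
  ext x
  rw [convolution_eq_swap]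
  rfl

lemma one_le_of_neg_cast_lt {ζ : ℝ} (hζd : -(d : ℝ) < ζ) (hζ : ζ < 0) : 1 ≤ d := by
  have : (0 : ℝ) < d := by linarith
  exact_mod_cast this

lemma locallyIntegrable_of_norm_le {ζ : ℝ} (hζd : -(d : ℝ) < ζ) (hζ : ζ < 0)
    {K : EuclideanSpace ℝ (Fin d) → ℝ} (hK : ContinuousOn K {x | x ≠ 0}) {A : ℝ}
    (hA : ∀ x ≠ 0, ‖K x‖ ≤ A * ‖x‖ ^ ζ) : LocallyIntegrable K := by
  have hd := one_le_of_neg_cast_lt hζd hζ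
  have : Nonempty (Fin d) := ⟨⟨0, hd⟩⟩
  have hne : ∀ᵐ x : EuclideanSpace ℝ (Fin d), x ≠ 0 := Measure.ae_ne volume 0
  refine locallyIntegrable_of_norm_le_rpow (C := A) (α := -ζ) (by simpa using hd)
    (by simp; linarith) ?_ ?_
  · filter_upwards [hne] with x hx
    simpa using hA x hx
  · have h := hK.aestronglyMeasurable (μ := volume) isOpen_ne.measurableSet
    have hres : volume.restrict {x : EuclideanSpace ℝ (Fin d) | x ≠ 0} = volume :=
      Measure.restrict_eq_self_of_ae_mem hne
    rwa [hres] at h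

lemma setIntegral_closedBall_norm_le {ζ : ℝ} (hζd : -(d : ℝ) < ζ) (hζ : ζ < 0)
    {K : EuclideanSpace ℝ (Fin d) → ℝ} (hK : ContinuousOn K {x | x ≠ 0}) {A : ℝ}
    (hA : ∀ x ≠ 0, ‖K x‖ ≤ A * ‖x‖ ^ ζ) {R r : ℝ} {x : EuclideanSpace ℝ (Fin d)}
    (hx : R + ‖x‖ ≤ r) :
    ∫ t in closedBall x R, ‖K t‖ ≤
      A * ∫ t in closedBall (0 : EuclideanSpace ℝ (Fin d)) r, ‖t‖ ^ ζ := by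
  have hd := one_le_of_neg_cast_lt hζd hζ
  have : Nonempty (Fin d) := ⟨⟨0, hd⟩⟩
  have hpow : LocallyIntegrable fun t : EuclideanSpace ℝ (Fin d) => ‖t‖ ^ ζ := by
    refine locallyIntegrable_of_norm_le (A := 1) hζd hζ ?_ fun t _ => ?_
    · exact continuous_norm.continuousOn.rpow_const fun t ht => Or.inl (norm_ne_zero_iff.mpr ht)
    · rw [Real.norm_of_nonneg (by positivity), one_mul]
  have hKint := ((locallyIntegrable_of_norm_le hζd hζ hK hA).integrableOn_isCompact
    (isCompact_closedBall 0 r)).norm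
  rw [← integral_const_mul]
  refine (setIntegral_mono_set hKint (Eventually.of_forall fun t => norm_nonneg _)
    (closedBall_subset_closedBall' ?_).eventuallyLE).trans ?_
  · rwa [dist_zero_right]
  · refine integral_mono_ae hKint
      ((hpow.integrableOn_isCompact (isCompact_closedBall 0 r)).const_mul A) ?_
    filter_upwards [ae_restrict_of_ae (Measure.ae_ne volume 0)] with t ht
    exact hA t ht

/-- The mollification estimate at unit scale, for a single order of differentiation. -/
lemma exists_norm_iteratedFDeriv_sub_convol_le {ζ ζb : ℝ} (hζd : -(d : ℝ) < ζ) (hζ : ζ < 0)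
    (hζb : ζb ∈ Set.Ico (ζ - 1) ζ) {ρ : EuclideanSpace ℝ (Fin d) → ℝ} (hρ : ContDiff ℝ ∞ ρ)
    (hρc : HasCompactSupport ρ) (hρi : ∫ x, ρ x = 1) (k : ℕ) :
    ∃ C : ℝ, 0 ≤ C ∧ ∀ (K : EuclideanSpace ℝ (Fin d) → ℝ) (A : ℝ), 0 ≤ A →
      ContDiffOn ℝ ∞ K {x | x ≠ 0} →
      (∀ j ≤ k + 1, ∀ x ≠ 0, ‖iteratedFDeriv ℝ j K x‖ ≤ A * ‖x‖ ^ (ζ - j)) →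
      ∀ x ≠ 0, ‖iteratedFDeriv ℝ k (fun x => K x - convol K ρ x) x‖ ≤
        C * A * ‖x‖ ^ (ζb - k) := by
  obtain ⟨R, hR0, hR⟩ : ∃ R : ℝ, 0 < R ∧ tsupport ρ ⊆ closedBall 0 R := by
    obtain ⟨r, hr⟩ := hρc.isCompact.isBounded.subset_closedBall 0
    exact ⟨max r 1, by positivity, hr.trans (closedBall_subset_closedBall (le_max_left _ _))⟩
  obtain ⟨B, hB⟩ := (hρc.iteratedFDeriv (𝕜 := ℝ) k).exists_bound_of_continuous
    (hρ.continuous_iteratedFDeriv (m := k) (mod_cast le_top))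
  have hB0 : 0 ≤ B := (norm_nonneg _).trans (hB 0)
  set P := ∫ y, ‖ρ y‖ with hP
  have hP0 : 0 ≤ P := integral_nonneg fun y => norm_nonneg _
  set J := ∫ t in closedBall (0 : EuclideanSpace ℝ (Fin d)) (3 * R), ‖t‖ ^ ζ with hJ
  have hJ0 : 0 ≤ J := integral_nonneg fun y => by positivity
  set Cfar := P * ((2⁻¹ : ℝ) ^ (ζ - (k + 1 : ℕ)) * (2 * R) ^ (ζ - 1 - ζb) * R) with hCfar
  set Cnear := (2 * R) ^ (ζ - ζb) + B * J * ((2 * R) ^ (ζb - k))⁻¹ with hCnear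
  have hCfar0 : 0 ≤ Cfar := by positivity
  have hCnear0 : 0 ≤ Cnear := by positivity
  clear_value Cfar Cnear P J
  refine ⟨Cfar + Cnear, by positivity, fun K A hA hK hbd x hx => ?_⟩
  have hx0 : 0 < ‖x‖ := norm_pos_iff.mpr hx
  have hK0 : ∀ x ≠ 0, ‖K x‖ ≤ A * ‖x‖ ^ ζ := fun y hy => by
    simpa using hbd 0 (by omega) y hy
  have hKloc := locallyIntegrable_of_norm_le hζd hζ hK.continuousOn hK0
  rcases le_or_gt (2 * R) ‖x‖ with hfar | hnear
  · have hconv : (fun x => K x - convol K ρ x) = fun x => K x - ∫ y, ρ y • K (x - y) := by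
      ext z
      simp only [convol, smul_eq_mul, mul_comm]
    rw [hconv]
    refine (norm_iteratedFDeriv_sub_integral_le hρ.continuous hR hρi k hK (by linarith)
      (B := A * (‖x‖ * 2⁻¹) ^ (ζ - (k + 1 : ℕ))) fun z hz => ?_).trans ?_
    · rw [mem_closedBall, dist_eq_norm, norm_sub_rev] at hz
      have h1 := norm_sub_norm_le x z
      have hz0 : ‖x‖ * 2⁻¹ ≤ ‖z‖ := by linarith
      have hzpos : 0 < ‖z‖ := by linarith
      refine (hbd (k + 1) le_rfl z (norm_pos_iff.mp hzpos)).trans ?_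
      refine mul_le_mul_of_nonneg_left ?_ hA
      refine Real.rpow_le_rpow_of_nonpos (by positivity) hz0 ?_
      push_cast
      linarith [(Nat.cast_nonneg k : (0 : ℝ) ≤ k)]
    · have h1 : ‖x‖ ^ (ζ - (k + 1 : ℕ)) ≤ (2 * R) ^ (ζ - 1 - ζb) * ‖x‖ ^ (ζb - k) := by
        have : ζ - ((k + 1 : ℕ) : ℝ) = (ζ - 1 - ζb) + (ζb - k) := by push_cast; ring
        rw [this, Real.rpow_add hx0]
        gcongr ?_ * _
        exact Real.rpow_le_rpow_of_nonpos (by positivity) hfar (by linarith [hζb.1])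
      rw [← hP, Real.mul_rpow hx0.le (by norm_num)]
      calc P * (A * (‖x‖ ^ (ζ - (k + 1 : ℕ)) * 2⁻¹ ^ (ζ - (k + 1 : ℕ))) * R)
          ≤ P * (A * ((2 * R) ^ (ζ - 1 - ζb) * ‖x‖ ^ (ζb - k) *
              2⁻¹ ^ (ζ - (k + 1 : ℕ))) * R) := by gcongr
        _ = Cfar * A * ‖x‖ ^ (ζb - k) := by rw [hCfar]; ring
        _ ≤ (Cfar + Cnear) * A * ‖x‖ ^ (ζb - k) := by gcongr; linarith
  · have hconv : (fun x => K x - convol K ρ x) =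
        K - K ⋆[ContinuousLinearMap.lsmul ℝ ℝ] ρ := by
      rw [convol_eq_convolution]; rfl
    have hKx : ContDiffAt ℝ k K x :=
      (hK.contDiffAt (isOpen_ne.mem_nhds hx)).of_le (mod_cast le_top)
    have hKρ : ContDiffAt ℝ k (K ⋆[ContinuousLinearMap.lsmul ℝ ℝ] ρ) x :=
      ((hρc.contDiff_convolution_right (ContinuousLinearMap.lsmul ℝ ℝ) hKloc hρ).of_le
        (mod_cast le_top)).contDiffAt
    rw [hconv, iteratedFDeriv_sub_apply hKx hKρ]
    refine (norm_sub_le _ _).trans ?_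
    have h1 : ‖x‖ ^ (ζ - k) ≤ (2 * R) ^ (ζ - ζb) * ‖x‖ ^ (ζb - k) := by
      have : ζ - (k : ℝ) = (ζ - ζb) + (ζb - k) := by ring
      rw [this, Real.rpow_add hx0]
      gcongr ?_ * _
      exact Real.rpow_le_rpow hx0.le hnear.le (by linarith [hζb.2])
    have h2 : 1 ≤ ((2 * R) ^ (ζb - k))⁻¹ * ‖x‖ ^ (ζb - k) := by
      rw [inv_mul_eq_div, one_le_div (by positivity)]
      refine Real.rpow_le_rpow_of_nonpos hx0 hnear.le ?_
      linarith [hζb.2, (Nat.cast_nonneg k : (0 : ℝ) ≤ k)]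
    have h3 := norm_iteratedFDeriv_convolution_le hKloc k hρ hR hB x
    have h4 := setIntegral_closedBall_norm_le hζd hζ hK.continuousOn hK0 (R := R) (r := 3 * R)
      (x := x) (by linarith)
    rw [← hJ] at h4
    calc _ ≤ A * ((2 * R) ^ (ζ - ζb) * ‖x‖ ^ (ζb - k)) + B * (A * J) * 1 := by
          refine add_le_add ((hbd k (by omega) x hx).trans ?_) (h3.trans ?_)
          · gcongr
          · rw [mul_one]; gcongr
      _ ≤ A * ((2 * R) ^ (ζ - ζb) * ‖x‖ ^ (ζb - k)) +
          B * (A * J) * (((2 * R) ^ (ζb - k))⁻¹ * ‖x‖ ^ (ζb - k)) := by gcongr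
      _ = Cnear * A * ‖x‖ ^ (ζb - k) := by rw [hCnear]; ring
      _ ≤ (Cfar + Cnear) * A * ‖x‖ ^ (ζb - k) := by gcongr; linarith

lemma convol_mollify_comp_smul (K ρ : EuclideanSpace ℝ (Fin d) → ℝ) {ε : ℝ} (hε : 0 < ε)
    (x : EuclideanSpace ℝ (Fin d)) :
    convol K (mollify ρ ε) x = convol (fun z => K (ε • z)) ρ (ε⁻¹ • x) := by
  have h := Measure.integral_comp_inv_smul volume
    (fun y : EuclideanSpace ℝ (Fin d) => K (x - ε • y) * ρ y) ε
  rw [finrank_euclideanSpace_fin, abs_of_pos (by positivity)] at h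
  simp only [convol, mollify, smul_sub, smul_inv_smul₀ hε.ne'] at h ⊢
  have h' : ∀ y, K (x - y) * (ε ^ (-(d : ℤ)) * ρ (ε⁻¹ • y)) =
      ε ^ (-(d : ℤ)) * (K (x - y) * ρ (ε⁻¹ • y)) := fun y => by ring
  simp_rw [h']
  rw [integral_const_mul, h, smul_eq_mul, ← mul_assoc, zpow_neg, zpow_natCast,
    inv_mul_cancel₀ (by positivity), one_mul]

/-- The mollification estimate at scale `ε`, obtained from unit scale by rescaling. -/
lemma exists_norm_iteratedFDeriv_sub_convol_mollify_le {ζ ζb : ℝ} (hζd : -(d : ℝ) < ζ)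
    (hζ : ζ < 0) (hζb : ζb ∈ Set.Ico (ζ - 1) ζ) {ρ : EuclideanSpace ℝ (Fin d) → ℝ}
    (hρ : ContDiff ℝ ∞ ρ) (hρc : HasCompactSupport ρ) (hρi : ∫ x, ρ x = 1) (k : ℕ) :
    ∃ C : ℝ, 0 ≤ C ∧ ∀ (K : EuclideanSpace ℝ (Fin d) → ℝ) (A : ℝ), 0 ≤ A →
      ContDiffOn ℝ ∞ K {x | x ≠ 0} →
      (∀ j ≤ k + 1, ∀ x ≠ 0, ‖iteratedFDeriv ℝ j K x‖ ≤ A * ‖x‖ ^ (ζ - j)) →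
      ∀ ε > 0, ∀ x ≠ 0, ‖iteratedFDeriv ℝ k (fun x => K x - convol K (mollify ρ ε) x) x‖ ≤
        C * A * ε ^ (ζ - ζb) * ‖x‖ ^ (ζb - k) := by
  obtain ⟨C, hC, h⟩ := exists_norm_iteratedFDeriv_sub_convol_le hζd hζ hζb hρ hρc hρi k
  refine ⟨C, hC, fun K A hA hK hbd ε hε x hx => ?_⟩
  have hx0 : 0 < ‖x‖ := norm_pos_iff.mpr hx
  set K' : EuclideanSpace ℝ (Fin d) → ℝ := fun z => K (ε • z) with hK'
  have hresc : (fun x => K x - convol K (mollify ρ ε) x) =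
      fun x => (fun z => K' z - convol K' ρ z) (ε⁻¹ • x) := by
    ext z
    rw [convol_mollify_comp_smul K ρ hε z]
    simp [hK', smul_inv_smul₀ hε.ne']
  have hK's : ContDiffOn ℝ ∞ K' {x | x ≠ 0} :=
    hK.comp (contDiff_const_smul ε).contDiffOn fun z hz => smul_ne_zero hε.ne' hz
  have hbd' : ∀ j ≤ k + 1, ∀ x ≠ 0,
      ‖iteratedFDeriv ℝ j K' x‖ ≤ A * ε ^ ζ * ‖x‖ ^ (ζ - j) := fun j hj y hy => by
    rw [hK', norm_iteratedFDeriv_comp_smul, abs_of_pos hε]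
    calc _ ≤ ε ^ j * (A * ‖ε • y‖ ^ (ζ - j)) := by
          gcongr
          exact hbd j hj _ (smul_ne_zero hε.ne' hy)
      _ = _ := by
          rw [norm_smul, Real.norm_of_nonneg hε.le, Real.mul_rpow hε.le (norm_nonneg y),
            Real.rpow_sub hε, Real.rpow_natCast]
          field_simp
  have hmain := h K' (A * ε ^ ζ) (by positivity) hK's hbd' (ε⁻¹ • x)
    (smul_ne_zero (inv_ne_zero hε.ne') hx)
  rw [hresc, norm_iteratedFDeriv_comp_smul k (fun z => K' z - convol K' ρ z), abs_of_pos (inv_pos.mpr hε)]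
  calc _ ≤ ε⁻¹ ^ k * (C * (A * ε ^ ζ) * ‖ε⁻¹ • x‖ ^ (ζb - k)) := by gcongr
    _ = _ := by
      rw [norm_smul, Real.norm_of_nonneg (by positivity), Real.mul_rpow (by positivity)
        hx0.le, Real.inv_rpow hε.le, Real.rpow_sub hε ζb, Real.rpow_sub hε, Real.rpow_natCast,
        inv_pow]
      field_simp

lemma norm_iteratedFDeriv_le_of_knorm_le {K : EuclideanSpace ℝ (Fin d) → ℝ} {ζ A : ℝ}
    (hA : 0 ≤ A) {m : ℕ} (h : knorm K ζ m ≤ ENNReal.ofReal A) {k : ℕ} (hk : k ≤ m)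
    {x : EuclideanSpace ℝ (Fin d)} (hx : x ≠ 0) :
    ‖iteratedFDeriv ℝ k K x‖ ≤ A * ‖x‖ ^ (ζ - k) := by
  have hx0 : 0 < ‖x‖ := norm_pos_iff.mpr hx
  have h1 := (iSup₂_le_iff.mp h) ⟨k, by omega⟩ ⟨x, hx⟩
  rw [ENNReal.ofReal_le_ofReal_iff hA] at h1
  have h2 : ‖x‖ ^ (ζ - k) * ‖x‖ ^ ((k : ℝ) - ζ) = 1 := by
    rw [← Real.rpow_add hx0]; simp
  calc ‖iteratedFDeriv ℝ k K x‖
      = ‖x‖ ^ (ζ - k) * (‖x‖ ^ ((k : ℝ) - ζ) * ‖iteratedFDeriv ℝ k K x‖) := by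
        rw [← mul_assoc, h2, one_mul]
    _ ≤ ‖x‖ ^ (ζ - k) * A := by gcongr
    _ = _ := mul_comm _ _

lemma knorm_le_of_norm_iteratedFDeriv_le {K : EuclideanSpace ℝ (Fin d) → ℝ} {ζ A : ℝ} {m : ℕ}
    (h : ∀ k ≤ m, ∀ x ≠ 0, ‖iteratedFDeriv ℝ k K x‖ ≤ A * ‖x‖ ^ (ζ - k)) :
    knorm K ζ m ≤ ENNReal.ofReal A := by
  refine iSup₂_le fun k x => ENNReal.ofReal_le_ofReal ?_
  have hx0 : 0 < ‖(x : EuclideanSpace ℝ (Fin d))‖ := norm_pos_iff.mpr x.2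
  calc _ ≤ ‖(x : EuclideanSpace ℝ (Fin d))‖ ^ (((k : ℕ) : ℝ) - ζ) *
        (A * ‖(x : EuclideanSpace ℝ (Fin d))‖ ^ (ζ - (k : ℕ))) := by
        gcongr
        exact h k (by omega) x x.2
    _ = A := by
        rw [mul_left_comm, ← Real.rpow_add hx0]; simp

/-- Passing to a higher order of differentiation costs a factor depending on the kernel. -/
lemma exists_knorm_le_mul {K : EuclideanSpace ℝ (Fin d) → ℝ} {ζ : ℝ}
    (hKord : ∀ m : ℕ, knorm K ζ m < ⊤) (m n : ℕ) :
    ∃ B : ℝ, 0 ≤ B ∧ knorm K ζ n ≤ ENNReal.ofReal (B * (knorm K ζ m).toReal) := by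
  rcases eq_or_ne (knorm K ζ m) 0 with h0 | h0
  · refine ⟨0, le_rfl, ?_⟩
    have hzero : ∀ x ≠ 0, K x = 0 := fun x hx => by
      simpa using norm_iteratedFDeriv_le_of_knorm_le le_rfl (k := 0) (m := m) (ζ := ζ) (K := K)
        (by simp [h0]) (by omega) hx
    rw [zero_mul]
    refine knorm_le_of_norm_iteratedFDeriv_le fun k _ x hx => ?_
    have h : K =ᶠ[𝓝 x] fun _ => 0 := by
      filter_upwards [isOpen_ne.mem_nhds hx] with y hy using hzero y hy
    rw [(h.iteratedFDeriv ℝ k).eq_of_nhds]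
    simp
  · have hpos := ENNReal.toReal_pos h0 (hKord m).ne
    refine ⟨(knorm K ζ n).toReal / (knorm K ζ m).toReal, by positivity, ?_⟩
    rw [div_mul_cancel₀ _ hpos.ne', ENNReal.ofReal_toReal (hKord n).ne]

end Kernel

end Auxiliary

/-- if `K` is smooth of order `ζ ∈ (-d,0)` and `ρ_ε` a mollifier, then for
every `ζ̄ ∈ [ζ-1, ζ)`, `⦀K - K*ρ_ε⦀_{ζ̄;m} ≤ C ε^{ζ-ζ̄} ⦀K⦀_{ζ;m}` for all `ε ∈ (0,1]`. -/
theorem mollification_error_bound (d : ℕ) (ζ : ℝ) (hζd : -(d : ℝ) < ζ) (hζ : ζ < 0)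
    (K : EuclideanSpace ℝ (Fin d) → ℝ) (hK : ContDiffOn ℝ (⊤ : ℕ∞) K {x | x ≠ 0})
    (hKord : ∀ m : ℕ, knorm K ζ m < ⊤)
    (ρ : EuclideanSpace ℝ (Fin d) → ℝ) (hρ : ContDiff ℝ (⊤ : ℕ∞) ρ)
    (hρc : HasCompactSupport ρ) (hρe : ∀ x, ρ (-x) = ρ x) (hρi : ∫ x, ρ x = 1)
    (ζb : ℝ) (hζb : ζb ∈ Set.Ico (ζ - 1) ζ) (m : ℕ) :
    ∃ C > 0, ∀ ε ∈ Set.Ioc (0 : ℝ) 1,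
      knorm (fun x => K x - convol K (mollify ρ ε) x) ζb m
        ≤ ENNReal.ofReal (C * ε ^ (ζ - ζb)) * knorm K ζ m := by

  choose C hC hbound using
    exists_norm_iteratedFDeriv_sub_convol_mollify_le hζd hζ hζb hρ hρc hρi
  obtain ⟨B, hB, hKB⟩ := exists_knorm_le_mul hKord m (m + 1)
  set N := (knorm K ζ m).toReal with hN
  have hN0 : 0 ≤ N := ENNReal.toReal_nonneg
  set S := ∑ k ∈ Finset.range (m + 1), C k with hS
  have hS0 : 0 ≤ S := Finset.sum_nonneg fun k _ => hC k
  refine ⟨S * B + 1, by positivity, fun ε hε => ?_⟩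
  have hε0 : 0 < ε := hε.1
  rw [← ENNReal.ofReal_toReal (hKord m).ne, ← hN, ← ENNReal.ofReal_mul (by positivity)]
  refine knorm_le_of_norm_iteratedFDeriv_le fun k hk x hx => ?_
  refine (hbound k K (B * N) (by positivity) hK (fun j hj y hy =>
    norm_iteratedFDeriv_le_of_knorm_le (by positivity) hKB (by omega) hy) ε hε0 x hx).trans ?_
  have hCS : C k ≤ S :=
    Finset.single_le_sum (fun j _ => hC j) (Finset.mem_range.mpr (by omega))
  calc C k * (B * N) * ε ^ (ζ - ζb) * ‖x‖ ^ (ζb - k)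
      = C k * B * ε ^ (ζ - ζb) * N * ‖x‖ ^ (ζb - k) := by ring
    _ ≤ (S * B + 1) * ε ^ (ζ - ζb) * N * ‖x‖ ^ (ζb - k) := by
      gcongr
      linarith [mul_le_mul_of_nonneg_right hCS hB]
end
end

section
/- Let K_1, K_2 be smooth, compactly supported functions on R^d \ {0} of orders ζ_1, ζ_2 with ζ_1 ∧ ζ_2 > -d, and set ζ = ζ_1 + ζ_2 + d. If ζ < 0, then the convolution K_1 * K_2 is of order ζ and ⦀K_1 * K_2⦀_{ζ;m} ≤ C ⦀K_1⦀_{ζ_1;m} ⦀K_2⦀_{ζ_2;m} for some constant C depending only on d, m, ζ_1, ζ_2. -/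
noncomputable section

open MeasureTheory Set ENNReal

open Metric Filter Topology Module

section ConvolutionBounds

theorem rpow_le_rpow_abs_mul_rpow {a b c : ℝ} (s : ℝ) (ha : 0 < a) (hb : 0 < b) (hc : 0 < c)
    (hab : a ≤ c * b) (hba : b ≤ c * a) : a ^ s ≤ c ^ |s| * b ^ s := by
  rcases le_total 0 s with hs | hs
  · rw [abs_of_nonneg hs, ← Real.mul_rpow hc.le hb.le]
    exact Real.rpow_le_rpow ha.le hab hs
  · have h : a ^ s ≤ (c⁻¹ * b) ^ s :=
      Real.rpow_le_rpow_of_nonpos (by positivity)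
        (by rw [inv_mul_le_iff₀ hc]; exact hba) hs
    rwa [Real.mul_rpow (by positivity) hb.le, Real.inv_rpow hc.le, ← Real.rpow_neg hc.le,
      ← abs_of_nonpos hs] at h

variable {E F : Type*} [NormedAddCommGroup E] [NormedSpace ℝ E]
  [NormedAddCommGroup F] [NormedSpace ℝ F]

theorem norm_iteratedFDeriv_comp_const_smul_le (f : E → F) {c : ℝ} (hc : 0 < c) (n : ℕ) (x : E) :
    ‖iteratedFDeriv ℝ n (fun z => f (c • z)) x‖ ≤ c ^ n * ‖iteratedFDeriv ℝ n f (c • x)‖ := by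
  set g : E ≃L[ℝ] E := ContinuousLinearEquiv.smulLeft (Units.mk0 c hc.ne') with hg
  have hgx : ∀ z, g z = c • z := fun z => rfl
  have h := g.iteratedFDerivWithin_comp_right f uniqueDiffOn_univ (mem_univ (g x)) n
  simp only [preimage_univ, iteratedFDerivWithin_univ, hgx] at h
  have hcomp : f ∘ g = fun z => f (c • z) := rfl
  rw [← hcomp, h]
  refine (ContinuousMultilinearMap.norm_compContinuousLinearMap_le _ _).trans ?_
  rw [Finset.prod_const, Finset.card_univ, Fintype.card_fin, mul_comm]
  gcongr
  refine ContinuousLinearMap.opNorm_le_bound _ hc.le fun z => ?_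
  simp [hgx, norm_smul, abs_of_pos hc]

theorem norm_iteratedFDeriv_comp_const_smul_le_of_homogeneous {m : ℕ} {f : E → F} {D u r : ℝ}
    (hr : 0 < r) (hf : ∀ j ≤ m, ∀ x ≠ 0, ‖iteratedFDeriv ℝ j f x‖ ≤ D * ‖x‖ ^ (u - j)) :
    ∀ j ≤ m, ∀ x ≠ 0,
      ‖iteratedFDeriv ℝ j (fun z => f (r • z)) x‖ ≤ r ^ u * D * ‖x‖ ^ (u - j) := by
  intro j hj y hy
  refine (norm_iteratedFDeriv_comp_const_smul_le f hr j y).trans ?_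
  have h1 := hf j hj (r • y) (smul_ne_zero hr.ne' hy)
  rw [norm_smul, Real.norm_of_nonneg hr.le, Real.mul_rpow hr.le (norm_nonneg _)] at h1
  calc r ^ j * ‖iteratedFDeriv ℝ j f (r • y)‖
      ≤ r ^ j * (D * (r ^ (u - j) * ‖y‖ ^ (u - j))) := by gcongr
    _ = (r ^ j * r ^ (u - j)) * D * ‖y‖ ^ (u - j) := by ring
    _ = _ := by
      rw [← Real.rpow_natCast r j, ← Real.rpow_add hr]
      congr 3
      ring

theorem contDiff_sub_mul_of_eventuallyEq_one {χ K : E → ℝ} (hχ : ContDiff ℝ (⊤ : ℕ∞) χ)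
    (hχ1 : χ =ᶠ[𝓝 0] 1) (hK : ContDiffOn ℝ (⊤ : ℕ∞) K {x | x ≠ 0}) :
    ContDiff ℝ (⊤ : ℕ∞) (fun y => K y - χ y * K y) := by
  rw [contDiff_iff_contDiffAt]
  intro x
  rcases eq_or_ne x 0 with rfl | hx
  · refine (contDiffAt_const (c := (0 : ℝ))).congr_of_eventuallyEq ?_
    filter_upwards [hχ1] with y hy
    simp [hy]
  · have hKx : ContDiffAt ℝ (⊤ : ℕ∞) K x := hK.contDiffAt (isOpen_ne.mem_nhds hx)
    exact hKx.sub (hχ.contDiffAt.mul hKx)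

theorem iteratedFDeriv_sub_mul_eq_zero {χ K : E → ℝ} {r : ℝ} (hχ : ∀ y, ‖y‖ < r → χ y = 1)
    (n : ℕ) {z : E} (hz : ‖z‖ < r) : iteratedFDeriv ℝ n (fun y => K y - χ y * K y) z = 0 := by
  have h : (fun y => K y - χ y * K y) =ᶠ[𝓝 z] fun _ => 0 := by
    filter_upwards [continuous_norm.continuousAt.eventually_lt_const hz] with y hy
    simp [hχ y hy]
  have h2 := (h.iteratedFDeriv ℝ n).eq_of_nhds
  rw [h2]
  simp

theorem exists_norm_iteratedFDeriv_sub_mul_le {χ : E → ℝ} (hχ : ContDiff ℝ (⊤ : ℕ∞) χ)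
    (hχc : HasCompactSupport χ) (m : ℕ) (s : ℝ) :
    ∃ M ≥ 0, ∀ (K : E → ℝ) (A : ℝ), 0 ≤ A → ContDiffOn ℝ (⊤ : ℕ∞) K {x | x ≠ 0} →
      (∀ j ≤ m, ∀ x ≠ 0, ‖iteratedFDeriv ℝ j K x‖ ≤ A * ‖x‖ ^ (s - j)) →
      ∀ k ≤ m, ∀ z, 1 / 4 ≤ ‖z‖ →
        ‖iteratedFDeriv ℝ k (fun y => K y - χ y * K y) z‖ ≤ M * A * ‖z‖ ^ s := by
  have hb : ∀ i : ℕ, ∃ C, ∀ x, ‖iteratedFDeriv ℝ i χ x‖ ≤ C := fun i =>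
    (hχ.continuous_iteratedFDeriv (by exact_mod_cast le_top)).bounded_above_of_compact_support
      (hχc.iteratedFDeriv i)
  choose C hC using hb
  have hC0 : ∀ i, 0 ≤ C i := fun i => (norm_nonneg _).trans (hC i 0)
  refine ⟨4 ^ m + ∑ k ∈ Finset.range (m + 1), ∑ i ∈ Finset.range (k + 1),
      (k.choose i : ℝ) * C i * 4 ^ m, ?_, ?_⟩
  · have : 0 ≤ ∑ k ∈ Finset.range (m + 1), ∑ i ∈ Finset.range (k + 1),
      (k.choose i : ℝ) * C i * 4 ^ m :=
      Finset.sum_nonneg fun k _ => Finset.sum_nonneg fun i _ => by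
        have := hC0 i; positivity
    positivity
  intro K A hA hK hbound k hk z hz
  have hzpos : 0 < ‖z‖ := by linarith
  have hz0 : z ≠ 0 := norm_pos_iff.1 hzpos
  have hKz : ContDiffAt ℝ (⊤ : ℕ∞) K z := hK.contDiffAt (isOpen_ne.mem_nhds hz0)
  have hkle : ((k : ℕ) : WithTop ℕ∞) ≤ ((⊤ : ℕ∞) : WithTop ℕ∞) := by exact_mod_cast le_top
  have hKj : ∀ j ≤ m, ‖iteratedFDeriv ℝ j K z‖ ≤ 4 ^ m * (A * ‖z‖ ^ s) := by
    intro j hj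
    refine (hbound j hj z hz0).trans ?_
    rw [Real.rpow_sub hzpos, Real.rpow_natCast, div_eq_mul_inv, ← inv_pow]
    have h4 : ‖z‖⁻¹ ^ j ≤ 4 ^ m := by
      have h1 : ‖z‖⁻¹ ≤ 4 := by
        rw [inv_le_comm₀ hzpos (by norm_num)]; linarith
      calc ‖z‖⁻¹ ^ j ≤ 4 ^ j := by gcongr
        _ ≤ 4 ^ m := pow_le_pow_right₀ (by norm_num) hj
    calc A * (‖z‖ ^ s * ‖z‖⁻¹ ^ j) = ‖z‖⁻¹ ^ j * (A * ‖z‖ ^ s) := by ring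
      _ ≤ _ := by gcongr
  have hmul : ‖iteratedFDeriv ℝ k (fun y => χ y * K y) z‖ ≤
      (∑ i ∈ Finset.range (k + 1), (k.choose i : ℝ) * C i * 4 ^ m) * (A * ‖z‖ ^ s) := by
    have hopen : IsOpen {x : E | x ≠ 0} := isOpen_ne
    have h := norm_iteratedFDerivWithin_mul_le (hχ.contDiffOn (s := {x | x ≠ 0})) hK
      hopen.uniqueDiffOn hz0 hkle
    simp only [iteratedFDerivWithin_of_isOpen _ hopen hz0] at h
    refine h.trans ?_
    rw [Finset.sum_mul]
    refine Finset.sum_le_sum fun i _ => ?_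
    have h1 := hC i z
    have h2 := hKj (k - i) (by omega)
    have := hC0 i
    calc (k.choose i : ℝ) * ‖iteratedFDeriv ℝ i χ z‖ * ‖iteratedFDeriv ℝ (k - i) K z‖
        ≤ (k.choose i : ℝ) * C i * (4 ^ m * (A * ‖z‖ ^ s)) := by gcongr
      _ = _ := by ring
  rw [fun_iteratedFDeriv_sub_apply (hKz.of_le hkle) ((hχ.contDiffAt.mul hKz).of_le hkle)]
  refine (norm_sub_le _ _).trans ?_
  have hsum : ∑ i ∈ Finset.range (k + 1), (k.choose i : ℝ) * C i * 4 ^ m ≤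
      ∑ k ∈ Finset.range (m + 1), ∑ i ∈ Finset.range (k + 1), (k.choose i : ℝ) * C i * 4 ^ m :=
    Finset.single_le_sum
      (f := fun k => ∑ i ∈ Finset.range (k + 1), (k.choose i : ℝ) * C i * 4 ^ m)
      (fun k _ => Finset.sum_nonneg fun i _ => by have := hC0 i; positivity)
      (Finset.mem_range.2 (by omega))
  have h3 := mul_le_mul_of_nonneg_right hsum (show 0 ≤ A * ‖z‖ ^ s by positivity)
  calc _ ≤ _ := add_le_add (hKj k hk) hmul
    _ ≤ _ := add_le_add le_rfl h3
    _ = _ := by ring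

variable [MeasurableSpace E] [BorelSpace E] {μ : Measure E}

theorem iteratedFDeriv_integral_smul_sub [SFinite μ] [μ.IsAddLeftInvariant] {f : E → ℝ} {g : E → F}
    (hf : LocallyIntegrable f μ) (hgc : HasCompactSupport g) (hg : ContDiff ℝ (⊤ : ℕ∞) g) (n : ℕ) :
    iteratedFDeriv ℝ n (fun x => ∫ y, f y • g (x - y) ∂μ) =
      fun x => ∫ y, f y • iteratedFDeriv ℝ n g (x - y) ∂μ := by
  induction n with
  | zero =>
    ext1 x
    simp only [iteratedFDeriv_zero_eq_comp, Function.comp_apply]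
    rw [← LinearIsometryEquiv.coe_toContinuousLinearEquiv,
      ← ContinuousLinearEquiv.integral_comp_comm]
    simp
  | succ n ih =>
    ext1 x
    have hG : ContDiff ℝ 1 (iteratedFDeriv ℝ n g) :=
      hg.iteratedFDeriv_right (m := 1) (by exact_mod_cast le_top)
    have h := ((hgc.iteratedFDeriv (𝕜 := ℝ) n).hasFDerivAt_convolution_right
      (ContinuousLinearMap.lsmul ℝ ℝ) hf hG x).fderiv
    have hconv : (fun x => ∫ y, f y • iteratedFDeriv ℝ n g (x - y) ∂μ) =
      convolution f (iteratedFDeriv ℝ n g) (ContinuousLinearMap.lsmul ℝ ℝ) μ := rfl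
    rw [iteratedFDeriv_succ_eq_comp_left, Function.comp_apply, ih, hconv, h, convolution_def]
    exact (ContinuousLinearEquiv.integral_comp_comm (𝕜 := ℝ) (X := E) (μ := μ)
      (E := E →L[ℝ] ContinuousMultilinearMap ℝ (fun _ : Fin n => E) F)
      (F := ContinuousMultilinearMap ℝ (fun _ : Fin (n + 1) => E) F)
      (continuousMultilinearCurryLeftEquiv ℝ (fun _ : Fin (n + 1) => E)
        F).symm.toContinuousLinearEquiv _).symm

variable [FiniteDimensional ℝ E] [μ.IsAddHaarMeasure]

theorem integrable_norm_rpow_mul_one_add_norm_rpow (hd : 1 ≤ finrank ℝ E) {s t : ℝ}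
    (hs : -(finrank ℝ E : ℝ) < s) (hst : s + t < -(finrank ℝ E : ℝ)) :
    Integrable (fun y : E => ‖y‖ ^ s * (1 + ‖y‖) ^ t) μ := by
  have hmeas : Measurable (fun y : E => ‖y‖ ^ s * (1 + ‖y‖) ^ t) := by fun_prop
  rw [← integrableOn_univ, ← union_compl_self (ball (0 : E) 1)]
  refine IntegrableOn.union ?_ ?_
  · refine integrableOn_ball_of_norm_le_rpow hd (C := 2 ^ |t|) (α := -s) (by linarith) ?_
      hmeas.aestronglyMeasurable
    refine (ae_restrict_iff' measurableSet_ball).2 (.of_forall fun y hy => ?_)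
    have hy1 : ‖y‖ < 1 := by simpa using hy
    have hy0 := norm_nonneg y
    have h := rpow_le_rpow_abs_mul_rpow t (a := 1 + ‖y‖) (b := 1) (c := 2) (by linarith)
      (by norm_num) (by norm_num) (by linarith) (by linarith)
    rw [Real.one_rpow, mul_one] at h
    rw [neg_neg, Real.norm_of_nonneg (by positivity), mul_comm]
    gcongr
  · have hint : Integrable (fun y : E => 2 ^ |s| * (1 + ‖y‖) ^ (s + t)) μ := by
      have := integrable_one_add_norm (E := E) (μ := μ) (r := -(s + t)) (by linarith)
      rw [neg_neg] at this
      exact this.const_mul _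
    refine Integrable.mono' hint.integrableOn hmeas.aestronglyMeasurable ?_
    refine (ae_restrict_iff' measurableSet_ball.compl).2 (.of_forall fun y hy => ?_)
    have hy1 : 1 ≤ ‖y‖ := by simpa using hy
    have h := rpow_le_rpow_abs_mul_rpow s (a := ‖y‖) (b := 1 + ‖y‖) (c := 2) (by linarith)
      (by linarith) (by norm_num) (by linarith) (by linarith)
    rw [Real.norm_of_nonneg (by positivity), Real.rpow_add (by linarith), ← mul_assoc]
    gcongr

theorem norm_integral_smul_sub_le (hd : 1 ≤ finrank ℝ E) {s t : ℝ}
    (hs : -(finrank ℝ E : ℝ) < s) (hst : s + t < -(finrank ℝ E : ℝ)) {f : E → ℝ} {g : E → F}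
    {A B : ℝ} (hf : ∀ y ≠ 0, ‖f y‖ ≤ A * ‖y‖ ^ s) (hA : 0 ≤ A) (hB : 0 ≤ B)
    (hg : ∀ z, 1 / 4 ≤ ‖z‖ → ‖g z‖ ≤ B * ‖z‖ ^ t) (hg0 : ∀ z, ‖z‖ < 1 / 4 → g z = 0)
    {x : E} (hx : ‖x‖ = 1) :
    ‖∫ y, f y • g (x - y) ∂μ‖ ≤ A * B * 9 ^ |t| * ∫ y, ‖y‖ ^ s * (1 + ‖y‖) ^ t ∂μ := by
  have : Nontrivial E := Module.nontrivial_of_finrank_pos (R := ℝ) hd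
  rw [← integral_const_mul]
  refine norm_integral_le_of_norm_le
    ((integrable_norm_rpow_mul_one_add_norm_rpow hd hs hst).const_mul _) ?_
  have hne : ∀ᵐ y ∂μ, y ≠ (0 : E) := compl_mem_ae_iff.2 (measure_singleton _)
  filter_upwards [hne] with y hy
  rcases lt_or_ge ‖x - y‖ (1 / 4) with h | h
  · rw [hg0 _ h, smul_zero, norm_zero]
    positivity
  · have h1 : ‖x - y‖ ≤ 1 + ‖y‖ := hx ▸ norm_sub_le x y
    have h2 : ‖y‖ ≤ 1 + ‖x - y‖ := by
      have := norm_sub_le x (x - y)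
      rwa [_root_.sub_sub_cancel, hx] at this
    have h3 := rpow_le_rpow_abs_mul_rpow t (a := ‖x - y‖) (b := 1 + ‖y‖) (c := 9) (by linarith)
      (by positivity) (by norm_num) (by linarith [norm_nonneg y]) (by linarith)
    rw [norm_smul]
    calc ‖f y‖ * ‖g (x - y)‖ ≤ (A * ‖y‖ ^ s) * (B * (9 ^ |t| * (1 + ‖y‖) ^ t)) := by
          gcongr
          · exact hf y hy
          · exact (hg _ h).trans (by gcongr)
      _ = _ := by ring

theorem locallyIntegrable_of_continuousOn_of_norm_le_rpow (hd : 1 ≤ finrank ℝ E) {s : ℝ}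
    (hs : -(finrank ℝ E : ℝ) < s) {K : E → ℝ} {A : ℝ} (hK : ContinuousOn K {x | x ≠ 0})
    (hb : ∀ y ≠ 0, ‖K y‖ ≤ A * ‖y‖ ^ s) : LocallyIntegrable K μ := by
  have : Nontrivial E := Module.nontrivial_of_finrank_pos (R := ℝ) hd
  have hne : ∀ᵐ y ∂μ, y ≠ (0 : E) := compl_mem_ae_iff.2 (measure_singleton _)
  refine locallyIntegrable_of_norm_le_rpow hd (C := A) (α := -s) (by linarith) ?_ ?_
  · filter_upwards [hne] with y hy
    rw [neg_neg]
    exact hb y hy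
  · have h := hK.aestronglyMeasurable (μ := μ) isOpen_ne.measurableSet
    have hset : {x : E | x ≠ 0} = {0}ᶜ := rfl
    rwa [hset, restrict_compl_singleton] at h

theorem exists_norm_iteratedFDeriv_convolution_le_of_norm_eq_one (μ : Measure E)
    [μ.IsAddHaarMeasure] (hd : 1 ≤ finrank ℝ E) (m : ℕ)
    {s t : ℝ} (hs : -(finrank ℝ E : ℝ) < s) (ht : -(finrank ℝ E : ℝ) < t)
    (hst : s + t < -(finrank ℝ E : ℝ)) :
    ∃ C > 0, ∀ (K L : E → ℝ) (A B : ℝ), 0 ≤ A → 0 ≤ B →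
      ContDiffOn ℝ (⊤ : ℕ∞) K {x | x ≠ 0} → ContDiffOn ℝ (⊤ : ℕ∞) L {x | x ≠ 0} →
      HasCompactSupport K → HasCompactSupport L →
      (∀ j ≤ m, ∀ x ≠ 0, ‖iteratedFDeriv ℝ j K x‖ ≤ A * ‖x‖ ^ (s - j)) →
      (∀ j ≤ m, ∀ x ≠ 0, ‖iteratedFDeriv ℝ j L x‖ ≤ B * ‖x‖ ^ (t - j)) →
      ∀ k ≤ m, ∀ x, ‖x‖ = 1 →
        ‖iteratedFDeriv ℝ k (fun x => ∫ y, K (x - y) * L y ∂μ) x‖ ≤ C * (A * B) := by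
  let χ : ContDiffBump (0 : E) := ⟨1 / 4, 1 / 3, by norm_num, by norm_num⟩
  have hχ : ContDiff ℝ (⊤ : ℕ∞) χ := χ.contDiff
  have hχ1 : ∀ y, ‖y‖ < 1 / 4 → χ y = 1 := fun y hy =>
    χ.one_of_mem_closedBall (mem_closedBall_zero_iff.2 hy.le)
  have hχ0 : ∀ y, 1 / 3 ≤ ‖y‖ → χ y = 0 := fun y hy =>
    χ.zero_of_le_dist (by rwa [dist_zero_right])
  obtain ⟨M, hM, hMb⟩ := exists_norm_iteratedFDeriv_sub_mul_le hχ χ.hasCompactSupport m s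
  obtain ⟨N, hN, hNb⟩ := exists_norm_iteratedFDeriv_sub_mul_le hχ χ.hasCompactSupport m t
  set I := ∫ y : E, ‖y‖ ^ s * (1 + ‖y‖) ^ t ∂μ with hI
  set J := ∫ y : E, ‖y‖ ^ t * (1 + ‖y‖) ^ s ∂μ with hJ
  have hI0 : 0 ≤ I := integral_nonneg fun y => by positivity
  have hJ0 : 0 ≤ J := integral_nonneg fun y => by positivity
  refine ⟨1 + (N * 9 ^ |t| * I + M * 9 ^ |s| * J), by positivity, ?_⟩
  intro K L A B hA hB hK hL hKc hLc hKb hLb k hk x hx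
  set K' : E → ℝ := fun y => K y - χ y * K y with hK'
  set L' : E → ℝ := fun y => L y - χ y * L y with hL'
  set P : E → ℝ := fun y => χ y * L y with hP
  have hK0 : ∀ y ≠ 0, ‖K y‖ ≤ A * ‖y‖ ^ s := fun y hy => by
    simpa using hKb 0 (Nat.zero_le _) y hy
  have hP0 : ∀ y ≠ 0, ‖P y‖ ≤ B * ‖y‖ ^ t := fun y hy => by
    have h1 : ‖L y‖ ≤ B * ‖y‖ ^ t := by simpa using hLb 0 (Nat.zero_le _) y hy
    refine le_trans ?_ h1
    rw [hP, norm_mul, Real.norm_of_nonneg χ.nonneg]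
    exact mul_le_of_le_one_left (norm_nonneg _) χ.le_one
  have hKint : LocallyIntegrable K μ :=
    locallyIntegrable_of_continuousOn_of_norm_le_rpow hd hs hK.continuousOn hK0
  have hPint : LocallyIntegrable P μ :=
    locallyIntegrable_of_continuousOn_of_norm_le_rpow hd ht
      (hχ.contDiffOn.continuousOn.mul hL.continuousOn) hP0
  have hK's : ContDiff ℝ (⊤ : ℕ∞) K' :=
    contDiff_sub_mul_of_eventuallyEq_one hχ χ.eventuallyEq_one hK
  have hL's : ContDiff ℝ (⊤ : ℕ∞) L' :=
    contDiff_sub_mul_of_eventuallyEq_one hχ χ.eventuallyEq_one hL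
  have hK'c : HasCompactSupport K' := hKc.sub hKc.mul_left
  have hL'c : HasCompactSupport L' := hLc.sub hLc.mul_left
  have hsplit : (fun x => ∫ y, K (x - y) * L y ∂μ) =ᶠ[𝓝 x]
      (fun x => (∫ y, K y • L' (x - y) ∂μ) + ∫ y, P y • K' (x - y) ∂μ) := by
    have hx' : (2 / 3 : ℝ) < ‖x‖ := by rw [hx]; norm_num
    filter_upwards [continuous_norm.continuousAt.eventually_const_lt hx'] with z hz
    have hint1 : Integrable (fun y => K y • L' (z - y)) μ :=
      hL'c.convolutionExists_right (ContinuousLinearMap.lsmul ℝ ℝ) hKint hL's.continuous z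
    have hint2 : Integrable (fun y => P y • K' (z - y)) μ :=
      hK'c.convolutionExists_right (ContinuousLinearMap.lsmul ℝ ℝ) hPint hK's.continuous z
    rw [← integral_sub_left_eq_self (fun y => K y • L' (z - y)) μ z,
      ← integral_add (hint1.comp_sub_left z) hint2]
    congr 1
    ext1 y
    simp only [_root_.sub_sub_cancel, smul_eq_mul, hK', hL', hP]
    rcases lt_or_ge ‖y‖ (1 / 3) with hy | hy
    · have hzy : χ (z - y) = 0 := hχ0 _ (by linarith [norm_sub_norm_le z y])
      rw [hzy]; ring
    · rw [hχ0 y hy]; ring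
  have hkle : ((k : ℕ) : WithTop ℕ∞) ≤ ((⊤ : ℕ∞) : WithTop ℕ∞) := by exact_mod_cast le_top
  have hsm1 : ContDiff ℝ (⊤ : ℕ∞) (fun x => ∫ y, K y • L' (x - y) ∂μ) :=
    hL'c.contDiff_convolution_right (ContinuousLinearMap.lsmul ℝ ℝ) hKint hL's
  have hsm2 : ContDiff ℝ (⊤ : ℕ∞) (fun x => ∫ y, P y • K' (x - y) ∂μ) :=
    hK'c.contDiff_convolution_right (ContinuousLinearMap.lsmul ℝ ℝ) hPint hK's
  rw [(hsplit.iteratedFDeriv ℝ k).eq_of_nhds,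
    fun_iteratedFDeriv_add_apply (hsm1.of_le hkle).contDiffAt (hsm2.of_le hkle).contDiffAt,
    iteratedFDeriv_integral_smul_sub hKint hL'c hL's,
    iteratedFDeriv_integral_smul_sub hPint hK'c hK's]
  have b1 := norm_integral_smul_sub_le (μ := μ) hd hs hst hK0 hA (mul_nonneg hN hB)
    (hNb L B hB hL hLb k hk) (fun z hz => iteratedFDeriv_sub_mul_eq_zero hχ1 k hz) hx
  have b2 := norm_integral_smul_sub_le (μ := μ) hd ht (by linarith) hP0 hB (mul_nonneg hM hA)
    (hMb K A hA hK hKb k hk) (fun z hz => iteratedFDeriv_sub_mul_eq_zero hχ1 k hz) hx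
  refine (norm_add_le _ _).trans ((add_le_add b1 b2).trans ?_)
  rw [← hI, ← hJ]
  nlinarith [mul_nonneg hA hB]

theorem exists_norm_iteratedFDeriv_convolution_le (μ : Measure E)
    [μ.IsAddHaarMeasure] (hd : 1 ≤ finrank ℝ E) (m : ℕ)
    {s t : ℝ} (hs : -(finrank ℝ E : ℝ) < s) (ht : -(finrank ℝ E : ℝ) < t)
    (hst : s + t < -(finrank ℝ E : ℝ)) :
    ∃ C > 0, ∀ (K L : E → ℝ) (A B : ℝ), 0 ≤ A → 0 ≤ B →
      ContDiffOn ℝ (⊤ : ℕ∞) K {x | x ≠ 0} → ContDiffOn ℝ (⊤ : ℕ∞) L {x | x ≠ 0} →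
      HasCompactSupport K → HasCompactSupport L →
      (∀ j ≤ m, ∀ x ≠ 0, ‖iteratedFDeriv ℝ j K x‖ ≤ A * ‖x‖ ^ (s - j)) →
      (∀ j ≤ m, ∀ x ≠ 0, ‖iteratedFDeriv ℝ j L x‖ ≤ B * ‖x‖ ^ (t - j)) →
      ∀ k ≤ m, ∀ x ≠ 0, ‖iteratedFDeriv ℝ k (fun x => ∫ y, K (x - y) * L y ∂μ) x‖ ≤
        C * (A * B) * ‖x‖ ^ (s + t + finrank ℝ E - k) := by
  obtain ⟨C, hC, h⟩ :=
    exists_norm_iteratedFDeriv_convolution_le_of_norm_eq_one μ hd m hs ht hst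
  refine ⟨C, hC, ?_⟩
  intro K L A B hA hB hK hL hKc hLc hKb hLb k hk x hx
  set r := ‖x‖ with hr
  have hr0 : 0 < r := norm_pos_iff.2 hx
  set n := finrank ℝ E
  have hmaps : MapsTo (fun z : E => r • z) {x | x ≠ 0} {x | x ≠ 0} := fun z hz =>
    smul_ne_zero hr0.ne' hz
  have hscale : ContDiff ℝ (⊤ : ℕ∞) (fun z : E => r • z) := contDiff_const_smul r
  have hK1 : ContDiffOn ℝ (⊤ : ℕ∞) (fun z => K (r • z)) {x | x ≠ 0} :=
    hK.comp hscale.contDiffOn hmaps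
  have hL1 : ContDiffOn ℝ (⊤ : ℕ∞) (fun z => L (r • z)) {x | x ≠ 0} :=
    hL.comp hscale.contDiffOn hmaps
  have hKr : ∀ j ≤ m, ∀ x ≠ 0, ‖iteratedFDeriv ℝ j (fun z => r ^ n • K (r • z)) x‖ ≤
      r ^ n * (r ^ s * A) * ‖x‖ ^ (s - j) := by
    intro j hj y hy
    have hjle : ((j : ℕ) : WithTop ℕ∞) ≤ ((⊤ : ℕ∞) : WithTop ℕ∞) := by exact_mod_cast le_top
    rw [iteratedFDeriv_const_smul_apply' ((hK1.contDiffAt (isOpen_ne.mem_nhds hy)).of_le hjle),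
      norm_smul, Real.norm_of_nonneg (by positivity), mul_assoc]
    gcongr
    exact norm_iteratedFDeriv_comp_const_smul_le_of_homogeneous hr0 hKb j hj y hy
  have hemb : IsClosedEmbedding (fun z : E => r • z) :=
    (Homeomorph.smulOfNeZero r hr0.ne').isClosedEmbedding
  have hKc1 : HasCompactSupport (fun z => K (r • z)) := hKc.comp_isClosedEmbedding hemb
  have hLc1 : HasCompactSupport (fun z => L (r • z)) := hLc.comp_isClosedEmbedding hemb
  have hK2 : ContDiffOn ℝ (⊤ : ℕ∞) (fun z => r ^ n • K (r • z)) {x | x ≠ 0} := hK1.const_smul _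
  have hKc2 : HasCompactSupport (fun z => r ^ n • K (r • z)) :=
    hKc1.mono fun z hz hz' => hz (by simp only [hz', smul_zero])
  have hA' : 0 ≤ r ^ n * (r ^ s * A) := by positivity
  have hB' : 0 ≤ r ^ t * B := by positivity
  have hx1 : ‖r⁻¹ • x‖ = 1 := by
    rw [norm_smul, norm_inv, Real.norm_of_nonneg hr0.le, ← hr, inv_mul_cancel₀ hr0.ne']
  have hLr := norm_iteratedFDeriv_comp_const_smul_le_of_homogeneous (f := L) hr0 hLb
  have hmain := h (fun z => r ^ n • K (r • z)) (fun z => L (r • z)) (r ^ n * (r ^ s * A))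
    (r ^ t * B) hA' hB' hK2 hL1 hKc2 hLc1 hKr hLr k hk (r⁻¹ • x) hx1
  have hconv : (fun x => ∫ y, K (x - y) * L y ∂μ) =
      fun z => (fun x => ∫ y, (r ^ n • K (r • (x - y))) * L (r • y) ∂μ) (r⁻¹ • z) := by
    ext1 z
    have h1 := Measure.integral_comp_smul_of_nonneg μ (fun y => K (z - y) * L y) r (hR := hr0.le)
    simp only [smul_sub, smul_inv_smul₀ hr0.ne', smul_eq_mul, mul_assoc]
    rw [integral_const_mul, h1, smul_eq_mul, mul_inv_cancel_left₀ (by positivity)]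
  rw [hconv]
  refine (norm_iteratedFDeriv_comp_const_smul_le
    (fun x => ∫ y, (r ^ n • K (r • (x - y))) * L (r • y) ∂μ) (inv_pos.2 hr0) k x).trans ?_
  calc _ ≤ r⁻¹ ^ k * (C * (r ^ n * (r ^ s * A) * (r ^ t * B))) := by gcongr
    _ = C * (A * B) * (r ^ s * r ^ t * r ^ n / r ^ k) := by
      rw [inv_pow]; ring
    _ = _ := by
      rw [Real.rpow_sub hr0, Real.rpow_add hr0, Real.rpow_add hr0, Real.rpow_natCast,
        Real.rpow_natCast]

end ConvolutionBounds

theorem norm_iteratedFDeriv_le_of_knorm_lt_top {d : ℕ} {K : EuclideanSpace ℝ (Fin d) → ℝ} {ζ : ℝ}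
    {m : ℕ} (hK : knorm K ζ m < ⊤) {j : ℕ} (hj : j ≤ m) {x : EuclideanSpace ℝ (Fin d)}
    (hx : x ≠ 0) :
    ‖iteratedFDeriv ℝ j K x‖ ≤ (knorm K ζ m).toReal * ‖x‖ ^ (ζ - j) := by
  have hx0 : 0 < ‖x‖ := norm_pos_iff.2 hx
  have h : ENNReal.ofReal (‖x‖ ^ ((j : ℝ) - ζ) * ‖iteratedFDeriv ℝ j K x‖) ≤ knorm K ζ m :=
    le_iSup₂_of_le (⟨j, Nat.lt_succ_of_le hj⟩ : Fin (m + 1)) ⟨x, hx⟩ le_rfl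
  rw [ENNReal.ofReal_le_iff_le_toReal hK.ne] at h
  rw [← neg_sub, Real.rpow_neg hx0.le, inv_mul_eq_div, div_le_iff₀ (by positivity)] at h
  exact h

/-- if `K₁, K₂` are smooth, compactly supported, of orders `ζ₁, ζ₂` with
`ζ₁ ∧ ζ₂ > -d` and `ζ = ζ₁+ζ₂+d < 0`, then `K₁ * K₂` is of order `ζ` with
`⦀K₁*K₂⦀_{ζ;m} ≤ C ⦀K₁⦀_{ζ₁;m} ⦀K₂⦀_{ζ₂;m}`, `C = C(d,m,ζ₁,ζ₂)`. -/
theorem kernel_convolution_bound (d : ℕ) (m : ℕ) (ζ₁ ζ₂ : ℝ)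
    (hζd : -(d : ℝ) < min ζ₁ ζ₂) (hζ : ζ₁ + ζ₂ + d < 0) :
    ∃ C > 0, ∀ K₁ K₂ : EuclideanSpace ℝ (Fin d) → ℝ,
      ContDiffOn ℝ (⊤ : ℕ∞) K₁ {x | x ≠ 0} → ContDiffOn ℝ (⊤ : ℕ∞) K₂ {x | x ≠ 0} →
      HasCompactSupport K₁ → HasCompactSupport K₂ →
      (∀ m' : ℕ, knorm K₁ ζ₁ m' < ⊤) → (∀ m' : ℕ, knorm K₂ ζ₂ m' < ⊤) →
      knorm (convol K₁ K₂) (ζ₁ + ζ₂ + d) m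
        ≤ ENNReal.ofReal C * knorm K₁ ζ₁ m * knorm K₂ ζ₂ m := by
  obtain ⟨hζ₁, hζ₂⟩ := lt_min_iff.1 hζd
  have hd : 1 ≤ d := by
    rcases Nat.eq_zero_or_pos d with rfl | h
    · simp only [Nat.cast_zero, neg_zero, add_zero] at hζ₁ hζ₂ hζ
      linarith
    · exact h
  have hfin : finrank ℝ (EuclideanSpace ℝ (Fin d)) = d := finrank_euclideanSpace_fin
  obtain ⟨C, hC, h⟩ := exists_norm_iteratedFDeriv_convolution_le
    (volume : Measure (EuclideanSpace ℝ (Fin d))) (by rwa [hfin]) m (s := ζ₁) (t := ζ₂)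
    (by rwa [hfin]) (by rwa [hfin]) (by rw [hfin]; linarith)
  refine ⟨C, hC, fun K₁ K₂ hK₁ hK₂ hc₁ hc₂ hn₁ hn₂ => ?_⟩
  refine iSup₂_le fun k x => ?_
  have hx0 : 0 < ‖(x : EuclideanSpace ℝ (Fin d))‖ := norm_pos_iff.2 x.2
  have hb := h K₁ K₂ _ _ ENNReal.toReal_nonneg ENNReal.toReal_nonneg hK₁ hK₂ hc₁ hc₂
    (fun j hj y hy => norm_iteratedFDeriv_le_of_knorm_lt_top (hn₁ m) hj hy)
    (fun j hj y hy => norm_iteratedFDeriv_le_of_knorm_lt_top (hn₂ m) hj hy)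
    k (Nat.lt_succ_iff.1 k.2) x x.2
  rw [hfin, ← neg_sub, Real.rpow_neg hx0.le, ← div_eq_mul_inv, le_div_iff₀' (by positivity)] at hb
  refine (ENNReal.ofReal_le_ofReal hb).trans ?_
  rw [ENNReal.ofReal_mul hC.le, ENNReal.ofReal_mul ENNReal.toReal_nonneg,
    ENNReal.ofReal_toReal (hn₁ m).ne, ENNReal.ofReal_toReal (hn₂ m).ne, mul_assoc]
end
end

section
/- With Y_ε = G * ξ_ε where ξ_ε is the mollified white noise on R² and G the truncated Green function, the renormalisation constant C_ε := E[|∇Y_ε(0)|²] satisfies C_ε = -(1/(2π)) log ε + O(1) as ε → 0; that is, C_ε + (log ε)/(2π) stays bounded (and converges) as ε → 0. -/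
noncomputable section

open MeasureTheory Set ENNReal

open Filter Topology Convolution

/-- The Euclidean plane. -/
abbrev Plane : Type := EuclideanSpace ℝ (Fin 2)

/-- The partial derivative of `f` in the `i`-th coordinate direction. -/
def partialDeriv (i : Fin 2) (f : Plane → ℝ) : Plane → ℝ :=
  fun x => fderiv ℝ f x (EuclideanSpace.single i 1)

/-- The Laplacian in the plane, as a sum of second partial derivatives. -/
def planeLaplacian (f : Plane → ℝ) : Plane → ℝ :=
  fun x => ∑ i : Fin 2, partialDeriv i (partialDeriv i f) x

section Calculus

variable {f h : Plane → ℝ}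

lemma ContDiff.partialDeriv (hf : ContDiff ℝ (⊤ : ℕ∞) f) (i : Fin 2) :
    ContDiff ℝ (⊤ : ℕ∞) (partialDeriv i f) := by
  unfold _root_.partialDeriv
  exact (hf.fderiv_right (m := (⊤ : ℕ∞)) (by simp)).clm_apply contDiff_const

lemma HasCompactSupport.partialDeriv (hf : HasCompactSupport f) (i : Fin 2) :
    HasCompactSupport (partialDeriv i f) :=
  hf.fderiv_apply ℝ _

lemma ContDiff.planeLaplacian (hf : ContDiff ℝ (⊤ : ℕ∞) f) :
    ContDiff ℝ (⊤ : ℕ∞) (planeLaplacian f) :=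
  ContDiff.sum fun i _ => (hf.partialDeriv i).partialDeriv i

lemma HasCompactSupport.planeLaplacian (hf : HasCompactSupport f) :
    HasCompactSupport (planeLaplacian f) := by
  have : _root_.planeLaplacian f = _root_.partialDeriv 0 (_root_.partialDeriv 0 f) +
      _root_.partialDeriv 1 (_root_.partialDeriv 1 f) := by
    ext x; simp [_root_.planeLaplacian]
  rw [this]
  exact ((hf.partialDeriv 0).partialDeriv 0).add ((hf.partialDeriv 1).partialDeriv 1)

lemma planeLaplacian_add (hf : ContDiff ℝ (⊤ : ℕ∞) f) (hh : ContDiff ℝ (⊤ : ℕ∞) h) (x : Plane) :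
    planeLaplacian (fun y => f y + h y) x = planeLaplacian f x + planeLaplacian h x := by
  have key : ∀ {a b : Plane → ℝ}, ContDiff ℝ (⊤ : ℕ∞) a → ContDiff ℝ (⊤ : ℕ∞) b → ∀ i,
      partialDeriv i (fun y => a y + b y) = fun y => partialDeriv i a y + partialDeriv i b y := by
    intro a b ha hb i
    ext y
    simp only [partialDeriv]
    rw [fderiv_fun_add (ha.differentiable (by simp) y) (hb.differentiable (by simp) y)]
    rfl
  simp only [planeLaplacian, key hf hh, key (hf.partialDeriv _) (hh.partialDeriv _),
    Finset.sum_add_distrib]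

lemma planeLaplacian_congr {x : Plane} (hfh : f =ᶠ[𝓝 x] h) :
    planeLaplacian f x = planeLaplacian h x := by
  have key : ∀ {a b : Plane → ℝ}, a =ᶠ[𝓝 x] b → ∀ i,
      partialDeriv i a =ᶠ[𝓝 x] partialDeriv i b := by
    intro a b hab i
    filter_upwards [hab.fderiv (𝕜 := ℝ)] with y hy
    simp only [partialDeriv, hy]
  exact Finset.sum_congr rfl fun i _ => (key (key hfh i) i).eq_of_nhds

lemma integrable_mul_of_hasCompactSupport (hf : LocallyIntegrable f) (hh : Continuous h)
    (hhc : HasCompactSupport h) : Integrable (fun x => f x * h x) :=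
  hf.integrable_smul_right_of_hasCompactSupport hh hhc

lemma integral_mul_partialDeriv (hf : ContDiff ℝ (⊤ : ℕ∞) f) (hh : ContDiff ℝ (⊤ : ℕ∞) h)
    (hhc : HasCompactSupport h) (i : Fin 2) :
    ∫ x, f x * partialDeriv i h x = -∫ x, partialDeriv i f x * h x :=
  integral_mul_fderiv_eq_neg_fderiv_mul_of_integrable
    (integrable_mul_of_hasCompactSupport (hf.partialDeriv i).continuous.locallyIntegrable
      hh.continuous hhc)
    (integrable_mul_of_hasCompactSupport hf.continuous.locallyIntegrable
      (hh.partialDeriv i).continuous (hhc.partialDeriv i))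
    (integrable_mul_of_hasCompactSupport hf.continuous.locallyIntegrable hh.continuous hhc)
    (fun x _ => hf.differentiable (by simp) x) (fun x _ => hh.differentiable (by simp) x)

lemma integral_mul_planeLaplacian (hf : ContDiff ℝ (⊤ : ℕ∞) f) (hh : ContDiff ℝ (⊤ : ℕ∞) h)
    (hhc : HasCompactSupport h) :
    ∫ x, f x * planeLaplacian h x = ∫ x, planeLaplacian f x * h x := by
  simp only [planeLaplacian, Finset.mul_sum, Finset.sum_mul]
  rw [integral_finsetSum, integral_finsetSum]
  · refine Finset.sum_congr rfl fun i _ => ?_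
    rw [integral_mul_partialDeriv hf (hh.partialDeriv i) (hhc.partialDeriv i),
      integral_mul_partialDeriv (hf.partialDeriv i) hh hhc, neg_neg]
  · exact fun i _ => integrable_mul_of_hasCompactSupport
      ((hf.partialDeriv i).partialDeriv i).continuous.locallyIntegrable hh.continuous hhc
  · exact fun i _ => integrable_mul_of_hasCompactSupport hf.continuous.locallyIntegrable
      ((hh.partialDeriv i).partialDeriv i).continuous ((hhc.partialDeriv i).partialDeriv i)

/-- Green's identity for the Dirichlet energy. -/
lemma sum_integral_partialDeriv_sq (hf : ContDiff ℝ (⊤ : ℕ∞) f) (hfc : HasCompactSupport f) :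
    ∑ i : Fin 2, ∫ x, partialDeriv i f x ^ 2 = -∫ x, f x * planeLaplacian f x := by
  simp only [planeLaplacian, Finset.mul_sum]
  rw [integral_finsetSum, ← Finset.sum_neg_distrib]
  · refine Finset.sum_congr rfl fun i _ => ?_
    rw [integral_mul_partialDeriv hf (hf.partialDeriv i) (hfc.partialDeriv i), neg_neg]
    simp only [sq]
  · exact fun i _ => integrable_mul_of_hasCompactSupport hf.continuous.locallyIntegrable
      ((hf.partialDeriv i).partialDeriv i).continuous ((hfc.partialDeriv i).partialDeriv i)

end Calculus

section Convolution

variable {f h r : Plane → ℝ}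

lemma convol_eq_convolution_s15 (f h : Plane → ℝ) :
    convol f h = f ⋆[ContinuousLinearMap.mul ℝ ℝ] h := by
  ext x
  exact convolution_mul_swap.symm

lemma convol_comm (f h : Plane → ℝ) : convol f h = convol h f := by
  ext x
  rw [convol_eq_convolution_s15, convolution_mul]
  simp only [convol, mul_comm]

lemma contDiff_convol (hf : LocallyIntegrable f) (hh : ContDiff ℝ (⊤ : ℕ∞) h)
    (hhc : HasCompactSupport h) : ContDiff ℝ (⊤ : ℕ∞) (convol f h) := by
  rw [convol_eq_convolution_s15]
  exact hhc.contDiff_convolution_right _ hf hh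

lemma continuous_convol (hf : LocallyIntegrable f) (hh : Continuous h)
    (hhc : HasCompactSupport h) : Continuous (convol f h) := by
  rw [convol_eq_convolution_s15]
  exact hhc.continuous_convolution_right _ hf hh

lemma hasCompactSupport_convol (hfc : HasCompactSupport f)
    (hhc : HasCompactSupport h) : HasCompactSupport (convol f h) := by
  rw [convol_eq_convolution_s15]
  exact hfc.convolution _ hhc

lemma partialDeriv_convol (hf : LocallyIntegrable f) (hh : ContDiff ℝ (⊤ : ℕ∞) h)
    (hhc : HasCompactSupport h) (i : Fin 2) :
    partialDeriv i (convol f h) = convol f (partialDeriv i h) := by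
  ext x
  rw [convol_eq_convolution_s15, convol_eq_convolution_s15]
  unfold partialDeriv
  rw [(hhc.hasFDerivAt_convolution_right _ hf (hh.of_le (by simp)) x).fderiv,
    convolution_precompR_apply _ hf (hhc.fderiv ℝ) (hh.continuous_fderiv (by simp))]

lemma planeLaplacian_convol (hf : LocallyIntegrable f) (hh : ContDiff ℝ (⊤ : ℕ∞) h)
    (hhc : HasCompactSupport h) (x : Plane) :
    planeLaplacian (convol f h) x = convol f (planeLaplacian h) x := by
  simp only [planeLaplacian, partialDeriv_convol hf hh hhc,
    partialDeriv_convol hf (hh.partialDeriv _) (hhc.partialDeriv _)]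
  simp only [convol_eq_convolution_s15, convolution_mul, planeLaplacian, Finset.mul_sum]
  rw [integral_finsetSum]
  exact fun i _ => ((hhc.partialDeriv i).partialDeriv i).convolutionExists_right
    (ContinuousLinearMap.mul ℝ ℝ) hf ((hh.partialDeriv i).partialDeriv i).continuous x

/-- Convolution with an even kernel is self-adjoint. -/
lemma integral_convol_mul (hf : Integrable f) (hr : Integrable r) (hre : ∀ x, r (-x) = r x)
    (hh : Continuous h) (hhc : HasCompactSupport h) :
    ∫ x, convol f r x * h x = ∫ x, f x * convol h r x := by
  have e1 : ∀ x, convol f r x * h x = ∫ y, f y * r (x - y) * h x := by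
    intro x
    rw [convol_eq_convolution_s15, convolution_mul, integral_mul_const]
  have e2 : ∀ y, f y * convol h r y = ∫ x, f y * r (x - y) * h x := by
    intro y
    rw [convol_eq_convolution_s15, convolution_mul, ← integral_const_mul]
    congr 1
    ext x
    rw [← hre (y - x), neg_sub]
    ring
  simp only [e1, e2]
  refine integral_integral_swap ?_
  obtain ⟨C, hC⟩ := hhc.exists_bound_of_continuous hh
  have h1 := Integrable.convolution_integrand (ContinuousLinearMap.mul ℝ ℝ) hf hr
    (μ := (volume : Measure Plane)) (ν := (volume : Measure Plane))
  have h2 := h1.bdd_mul (f := fun p : Plane × Plane => h p.1) (c := C)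
    (by exact (hh.comp continuous_fst).aestronglyMeasurable)
    (Eventually.of_forall fun p => hC _)
  refine h2.congr (Eventually.of_forall fun p => ?_)
  simp only [ContinuousLinearMap.mul_apply', Function.uncurry]
  ring

end Convolution

section FundamentalSolution

lemma locallyIntegrable_log_norm : LocallyIntegrable fun x : Plane => Real.log ‖x‖ := by
  rw [locallyIntegrable_iff]
  intro K hK
  obtain ⟨R, hR⟩ := hK.isBounded.subset_ball 0
  have h1 : Integrable fun x : Plane => (Iio R).indicator Real.log ‖x‖ := by
    rw [integrable_fun_norm_addHaar volume (f := (Iio R).indicator Real.log)]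
    have h2 : IntegrableOn (fun y : ℝ => y * Real.log y) (Iio R ∩ Ioi 0) := by
      refine (Real.continuous_mul_log.integrableOn_Icc (a := 0) (b := R)).mono_set ?_
      exact fun y hy => ⟨hy.2.le, hy.1.le⟩
    have h3 := (integrable_indicator_iff (μ := volume.restrict (Ioi (0 : ℝ)))
      (measurableSet_Iio (a := R)) (f := fun y : ℝ => y * Real.log y)).2 (by
        rwa [IntegrableOn, Measure.restrict_restrict measurableSet_Iio])
    refine h3.congr (Eventually.of_forall fun y => ?_)
    simp only [finrank_euclideanSpace, Fintype.card_fin, Nat.add_one_sub_one, pow_one, smul_eq_mul]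
    by_cases hy : y ∈ Iio R <;> simp [indicator, hy]
  refine (h1.integrableOn (s := K)).congr_fun (fun x hx => ?_) hK.measurableSet
  have : ‖x‖ < R := by simpa using hR hx
  simp [indicator, this]

/-- A smooth regularisation of the fundamental solution of the Laplacian in the plane. -/
def regularisedLog (δ : ℝ) (x : Plane) : ℝ := -Real.log (‖x‖ ^ 2 + δ ^ 2) / (4 * Real.pi)

lemma norm_sq_add_sq_pos {δ : ℝ} (hδ : 0 < δ) (x : Plane) : 0 < ‖x‖ ^ 2 + δ ^ 2 := by positivity

lemma contDiff_regularisedLog {δ : ℝ} (hδ : 0 < δ) :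
    ContDiff ℝ (⊤ : ℕ∞) (regularisedLog δ) := by
  unfold regularisedLog
  exact (((contDiff_norm_sq ℝ).add contDiff_const).log
    fun x => (norm_sq_add_sq_pos hδ x).ne').neg.div_const _

lemma partialDeriv_regularisedLog {δ : ℝ} (hδ : 0 < δ) (i : Fin 2) :
    partialDeriv i (regularisedLog δ) =
      fun x => -(x i / (‖x‖ ^ 2 + δ ^ 2)) / (2 * Real.pi) := by
  ext x
  have h1 : HasFDerivAt (fun x : Plane => ‖x‖ ^ 2 + δ ^ 2) (2 • innerSL ℝ x) x :=
    (hasStrictFDerivAt_norm_sq x).hasFDerivAt.add_const _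
  have h2 := ((h1.log (norm_sq_add_sq_pos hδ x).ne').neg).mul_const ((4 * Real.pi)⁻¹)
  have h3 : fderiv ℝ (regularisedLog δ) x = _ := h2.fderiv
  simp only [partialDeriv, h3]
  have := norm_sq_add_sq_pos hδ x
  simp [EuclideanSpace.inner_single_right]
  field_simp
  ring

lemma partialDeriv_partialDeriv_regularisedLog {δ : ℝ} (hδ : 0 < δ) (i : Fin 2) (x : Plane) :
    partialDeriv i (partialDeriv i (regularisedLog δ)) x =
      -((‖x‖ ^ 2 + δ ^ 2 - 2 * x i ^ 2) / (‖x‖ ^ 2 + δ ^ 2) ^ 2) / (2 * Real.pi) := by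
  rw [partialDeriv_regularisedLog hδ]
  have h1 : HasFDerivAt (fun x : Plane => ‖x‖ ^ 2 + δ ^ 2) (2 • innerSL ℝ x) x :=
    (hasStrictFDerivAt_norm_sq x).hasFDerivAt.add_const _
  have h0 : HasFDerivAt (fun x : Plane => x i) (EuclideanSpace.proj i : Plane →L[ℝ] ℝ) x :=
    (EuclideanSpace.proj i : Plane →L[ℝ] ℝ).hasFDerivAt
  have hinv : HasFDerivAt (fun x : Plane => (‖x‖ ^ 2 + δ ^ 2)⁻¹) _ x :=
    (hasDerivAt_inv (norm_sq_add_sq_pos hδ x).ne').comp_hasFDerivAt x h1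
  have h2 := ((h0.mul hinv).neg).mul_const ((2 * Real.pi)⁻¹)
  have h3 : fderiv ℝ (fun x : Plane => -(x i / (‖x‖ ^ 2 + δ ^ 2)) / (2 * Real.pi)) x = _ :=
    h2.fderiv
  simp only [partialDeriv, h3]
  have := norm_sq_add_sq_pos hδ x
  simp [EuclideanSpace.inner_single_right]
  field_simp
  ring

lemma planeLaplacian_regularisedLog {δ : ℝ} (hδ : 0 < δ) (x : Plane) :
    planeLaplacian (regularisedLog δ) x =
      -(δ ^ 2 / (‖x‖ ^ 2 + δ ^ 2) ^ 2) / Real.pi := by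
  simp only [planeLaplacian, partialDeriv_partialDeriv_regularisedLog hδ, Fin.sum_univ_two]
  have := norm_sq_add_sq_pos hδ x
  have h : ‖x‖ ^ 2 = x 0 ^ 2 + x 1 ^ 2 := by
    rw [EuclideanSpace.real_norm_sq_eq, Fin.sum_univ_two]
  field_simp
  rw [h]
  ring

lemma integrableOn_integral_radial_profile :
    IntegrableOn (fun y : ℝ => y / (y ^ 2 + 1) ^ 2) (Ioi 0) ∧
      ∫ y in Ioi (0 : ℝ), y / (y ^ 2 + 1) ^ 2 = 1 / 2 := by
  have hd : ∀ x ∈ Ioi (0 : ℝ),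
      HasDerivAt (fun y : ℝ => -(1 / 2) * (y ^ 2 + 1)⁻¹) (x / (x ^ 2 + 1) ^ 2) x := by
    intro x _
    have h1 : HasDerivAt (fun y : ℝ => y ^ 2 + 1) (2 * x) x := by
      simpa using (hasDerivAt_pow 2 x).add_const 1
    refine ((h1.fun_inv (by positivity)).const_mul (-(1 / 2) : ℝ)).congr_deriv ?_
    field_simp
  have hc : ContinuousWithinAt (fun y : ℝ => -(1 / 2) * (y ^ 2 + 1)⁻¹) (Ici 0) 0 := by
    refine Continuous.continuousWithinAt ?_
    exact continuous_const.mul (Continuous.inv₀ (by fun_prop) fun y => by positivity)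
  have hn : ∀ x ∈ Ioi (0 : ℝ), 0 ≤ x / (x ^ 2 + 1) ^ 2 := fun x hx => by
    have : 0 < x := hx
    positivity
  have hl : Tendsto (fun y : ℝ => -(1 / 2) * (y ^ 2 + 1)⁻¹) atTop (𝓝 0) := by
    have : Tendsto (fun y : ℝ => y ^ 2 + 1) atTop atTop :=
      tendsto_atTop_add_const_right _ _ (tendsto_pow_atTop (by norm_num))
    simpa using this.inv_tendsto_atTop.const_mul (-(1 / 2) : ℝ)
  refine ⟨integrableOn_Ioi_deriv_of_nonneg hc hd hn hl, ?_⟩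
  rw [integral_Ioi_of_hasDerivAt_of_nonneg hc hd hn hl]
  norm_num

lemma integrable_inv_norm_sq_add_one_sq :
    Integrable fun x : Plane => ((‖x‖ ^ 2 + 1) ^ 2)⁻¹ := by
  rw [integrable_fun_norm_addHaar volume (f := fun y : ℝ => ((y ^ 2 + 1) ^ 2)⁻¹)]
  simpa [div_eq_mul_inv] using integrableOn_integral_radial_profile.1

lemma integral_inv_norm_sq_add_one_sq :
    ∫ x : Plane, ((‖x‖ ^ 2 + 1) ^ 2)⁻¹ = Real.pi := by
  rw [integral_fun_norm_addHaar volume (fun y : ℝ => ((y ^ 2 + 1) ^ 2)⁻¹)]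
  have h := integrableOn_integral_radial_profile.2
  simp only [div_eq_mul_inv] at h
  simp [Measure.real, EuclideanSpace.volume_ball_fin_two, h, Real.pi_pos.le]
  ring

lemma tendsto_integral_planeLaplacian_regularisedLog_mul {φ : Plane → ℝ} (hφ : Continuous φ)
    (hφc : HasCompactSupport φ) :
    Tendsto (fun δ : ℝ => ∫ x, planeLaplacian (regularisedLog δ) x * φ x) (𝓝[>] 0)
      (𝓝 (-φ 0)) := by
  obtain ⟨C, hC⟩ := hφc.exists_bound_of_continuous hφ
  have h1 : Tendsto (fun δ : ℝ => ∫ u : Plane, ((‖u‖ ^ 2 + 1) ^ 2)⁻¹ * φ (δ • u)) (𝓝[>] 0)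
      (𝓝 (∫ u : Plane, ((‖u‖ ^ 2 + 1) ^ 2)⁻¹ * φ 0)) := by
    refine tendsto_integral_filter_of_dominated_convergence
      (fun u : Plane => ((‖u‖ ^ 2 + 1) ^ 2)⁻¹ * C) ?_ ?_ ?_ ?_
    · refine Eventually.of_forall fun δ => Continuous.aestronglyMeasurable ?_
      exact (Continuous.inv₀ (by fun_prop) fun y => by positivity).mul
        (hφ.comp (continuous_const_smul δ))
    · refine Eventually.of_forall fun δ => Eventually.of_forall fun u => ?_
      rw [norm_mul, Real.norm_of_nonneg (by positivity)]
      gcongr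
      exact hC _
    · exact integrable_inv_norm_sq_add_one_sq.mul_const C
    · refine Eventually.of_forall fun u => Tendsto.const_mul _ ?_
      have : Tendsto (fun δ : ℝ => φ (δ • u)) (𝓝 0) (𝓝 (φ ((0 : ℝ) • u))) :=
        (hφ.comp (continuous_id.smul continuous_const)).tendsto 0
      rw [zero_smul] at this
      exact this.mono_left nhdsWithin_le_nhds
  rw [integral_mul_const, integral_inv_norm_sq_add_one_sq] at h1
  have h2 := h1.const_mul (-Real.pi⁻¹)
  have hpi := Real.pi_ne_zero
  rw [show -Real.pi⁻¹ * (Real.pi * φ 0) = -φ 0 by field_simp] at h2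
  refine h2.congr' ?_
  filter_upwards [self_mem_nhdsWithin] with δ hδ
  have hδ : 0 < δ := hδ
  have h3 := Measure.integral_comp_smul (volume : Measure Plane)
    (fun x => planeLaplacian (regularisedLog δ) x * φ x) δ
  rw [abs_of_pos (by positivity), smul_eq_mul] at h3
  have h4 : ∫ x, planeLaplacian (regularisedLog δ) x * φ x =
      δ ^ 2 * ∫ x, planeLaplacian (regularisedLog δ) (δ • x) * φ (δ • x) := by
    rw [h3]
    simp
    field_simp
  rw [h4, ← integral_const_mul, ← integral_const_mul]
  congr 1
  ext x
  rw [planeLaplacian_regularisedLog hδ, norm_smul, Real.norm_of_nonneg hδ.le]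
  have : (δ * ‖x‖) ^ 2 + δ ^ 2 = δ ^ 2 * (‖x‖ ^ 2 + 1) := by ring
  rw [this]
  have : 0 < ‖x‖ ^ 2 + 1 := by positivity
  field_simp

lemma abs_log_norm_sq_add_sq_le {δ : ℝ} (hδ : 0 < δ) (hδ1 : δ ≤ 1) {x : Plane} (hx : x ≠ 0) :
    |Real.log (‖x‖ ^ 2 + δ ^ 2)| ≤ 2 * |Real.log ‖x‖| + Real.log (‖x‖ ^ 2 + 1) := by
  have hx' : 0 < ‖x‖ := norm_pos_iff.2 hx
  have h1 : Real.log (‖x‖ ^ 2) ≤ Real.log (‖x‖ ^ 2 + δ ^ 2) :=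
    Real.log_le_log (by positivity) (by nlinarith)
  have h2 : Real.log (‖x‖ ^ 2 + δ ^ 2) ≤ Real.log (‖x‖ ^ 2 + 1) :=
    Real.log_le_log (by positivity) (by nlinarith)
  have h3 : 0 ≤ Real.log (‖x‖ ^ 2 + 1) := Real.log_nonneg (by nlinarith)
  rw [Real.log_pow] at h1
  push_cast at h1
  rw [abs_le]
  constructor
  · linarith [neg_abs_le (Real.log ‖x‖)]
  · linarith [abs_nonneg (Real.log ‖x‖)]

lemma tendsto_integral_regularisedLog_mul {φ : Plane → ℝ} (hφ : Continuous φ)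
    (hφc : HasCompactSupport φ) :
    Tendsto (fun δ : ℝ => ∫ x, regularisedLog δ x * φ x) (𝓝[>] 0)
      (𝓝 (∫ x, -Real.log ‖x‖ / (2 * Real.pi) * φ x)) := by
  have hne : ∀ᵐ x : Plane, x ≠ 0 := by
    simp [ae_iff]
  refine tendsto_integral_filter_of_dominated_convergence
    (fun x => (2 * |Real.log ‖x‖| + Real.log (‖x‖ ^ 2 + 1)) * ‖φ x‖ / (4 * Real.pi)) ?_ ?_ ?_ ?_
  · filter_upwards [self_mem_nhdsWithin] with δ hδ
    exact ((contDiff_regularisedLog hδ).continuous.mul hφ).aestronglyMeasurable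
  · filter_upwards [Ioc_mem_nhdsGT (zero_lt_one' ℝ)] with δ hδ
    filter_upwards [hne] with x hx
    rw [norm_mul, regularisedLog, norm_div, norm_neg,
      Real.norm_of_nonneg (r := 4 * Real.pi) (by positivity), div_mul_eq_mul_div]
    gcongr
    exact abs_log_norm_sq_add_sq_le hδ.1 hδ.2 hx
  · have hlog : LocallyIntegrable fun x : Plane =>
        2 * |Real.log ‖x‖| + Real.log (‖x‖ ^ 2 + 1) := by
      refine LocallyIntegrable.add ?_ ?_
      · exact (locallyIntegrable_log_norm.mono (g := fun x : Plane => |Real.log ‖x‖|)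
          locallyIntegrable_log_norm.aestronglyMeasurable.norm (by simp)).smul (2 : ℝ)
      · refine Continuous.locallyIntegrable ?_
        exact Continuous.log (by fun_prop) fun x => by positivity
    exact (integrable_mul_of_hasCompactSupport hlog hφ.norm hφc.norm).div_const _
  · filter_upwards [hne] with x hx
    refine Tendsto.mul_const _ ?_
    have hx' : 0 < ‖x‖ := norm_pos_iff.2 hx
    have h1 : Tendsto (fun δ : ℝ => ‖x‖ ^ 2 + δ ^ 2) (𝓝[>] 0) (𝓝 (‖x‖ ^ 2)) := by
      have : Continuous fun δ : ℝ => ‖x‖ ^ 2 + δ ^ 2 := by fun_prop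
      simpa using (this.tendsto 0).mono_left nhdsWithin_le_nhds
    have h2 := ((h1.log (by positivity)).neg).div_const (4 * Real.pi)
    have h3 : -Real.log (‖x‖ ^ 2) / (4 * Real.pi) = -Real.log ‖x‖ / (2 * Real.pi) := by
      rw [Real.log_pow]
      push_cast
      field_simp
      ring
    rwa [h3] at h2

/-- `-log ‖x‖ / (2π)` is a fundamental solution of `-Δ` in the plane. -/
lemma integral_log_norm_mul_planeLaplacian {φ : Plane → ℝ} (hφ : ContDiff ℝ (⊤ : ℕ∞) φ)
    (hφc : HasCompactSupport φ) :
    ∫ x, -Real.log ‖x‖ / (2 * Real.pi) * planeLaplacian φ x = -φ 0 := by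
  refine tendsto_nhds_unique
    (tendsto_integral_regularisedLog_mul hφ.planeLaplacian.continuous hφc.planeLaplacian)
    ((tendsto_integral_planeLaplacian_regularisedLog_mul hφ.continuous hφc).congr' ?_)
  filter_upwards [self_mem_nhdsWithin] with δ hδ
  exact (integral_mul_planeLaplacian (contDiff_regularisedLog hδ) hφ hφc).symm

end FundamentalSolution

section GreenFunction

variable {G : Plane → ℝ}

lemma contDiff_one_sub_bump_mul (hG : ContDiffOn ℝ (⊤ : ℕ∞) G {x | x ≠ 0})
    (χ : ContDiffBump (0 : Plane)) : ContDiff ℝ (⊤ : ℕ∞) fun x => (1 - χ x) * G x := by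
  rw [contDiff_iff_contDiffAt]
  intro x
  by_cases hx : x = 0
  · subst hx
    refine (contDiffAt_const (c := (0 : ℝ))).congr_of_eventuallyEq ?_
    filter_upwards [χ.eventuallyEq_one] with y hy
    simp [hy]
  · refine (contDiffAt_const.sub χ.contDiffAt).mul (hG.contDiffAt ?_)
    exact isOpen_ne.mem_nhds hx

lemma planeLaplacian_eq_zero {f : Plane → ℝ} {x : Plane} (hf : f =ᶠ[𝓝 x] fun _ => 0) :
    planeLaplacian f x = 0 := by
  rw [planeLaplacian_congr hf]
  have h : ∀ i, partialDeriv i (fun _ : Plane => (0 : ℝ)) = fun _ => 0 := fun i => by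
    ext y
    simp [partialDeriv]
  simp [planeLaplacian, h]

lemma integrable_of_log_singularity (hG : ContDiffOn ℝ (⊤ : ℕ∞) G {x | x ≠ 0})
    (hGc : HasCompactSupport G)
    (hGlog : ∀ x : Plane, x ≠ 0 → ‖x‖ ≤ 1 / 2 → G x = -Real.log ‖x‖ / (2 * Real.pi)) :
    Integrable G := by
  let χ : ContDiffBump (0 : Plane) := ⟨1 / 4, 1 / 2, by norm_num, by norm_num⟩
  have h1 : Integrable fun x => (1 - χ x) * G x :=
    (contDiff_one_sub_bump_mul hG χ).continuous.integrable_of_hasCompactSupport hGc.mul_left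
  have h2 : Integrable fun x : Plane => Real.log ‖x‖ * χ x :=
    integrable_mul_of_hasCompactSupport locallyIntegrable_log_norm χ.continuous χ.hasCompactSupport
  refine (h1.add ((h2.neg).div_const (2 * Real.pi))).congr ?_
  have hne : ∀ᵐ x : Plane, x ≠ 0 := by simp [ae_iff]
  filter_upwards [hne] with x hx
  simp only [Pi.add_apply, Pi.neg_apply]
  by_cases hx2 : ‖x‖ ≤ 1 / 2
  · rw [hGlog x hx hx2]
    ring
  · have : χ x = 0 := χ.zero_of_le_dist (by
      rw [dist_zero_right]; exact (not_le.1 hx2).le)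
    rw [this]
    ring

/-- In the sense of distributions, `ΔG = -δ₀ + F` with `F` continuous and compactly supported. -/
lemma exists_integral_mul_planeLaplacian_eq (hG : ContDiffOn ℝ (⊤ : ℕ∞) G {x | x ≠ 0})
    (hGc : HasCompactSupport G)
    (hGlog : ∀ x : Plane, x ≠ 0 → ‖x‖ ≤ 1 / 2 → G x = -Real.log ‖x‖ / (2 * Real.pi)) :
    ∃ F : Plane → ℝ, Continuous F ∧ HasCompactSupport F ∧
      ∀ ψ : Plane → ℝ, ContDiff ℝ (⊤ : ℕ∞) ψ → HasCompactSupport ψ →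
        ∫ x, G x * planeLaplacian ψ x = -ψ 0 + ∫ x, F x * ψ x := by
  let χ : ContDiffBump (0 : Plane) := ⟨1 / 4, 1 / 2, by norm_num, by norm_num⟩
  let η : ContDiffBump (0 : Plane) := ⟨1 / 16, 1 / 8, by norm_num, by norm_num⟩
  let K : Plane → ℝ := fun x => (1 - η x) * G x
  have hK : ContDiff ℝ (⊤ : ℕ∞) K := contDiff_one_sub_bump_mul hG η
  have hKc : HasCompactSupport K := hGc.mul_left
  refine ⟨fun x => planeLaplacian K x * (1 - χ x),
    hK.planeLaplacian.continuous.mul (continuous_const.sub χ.continuous),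
    hKc.planeLaplacian.mul_right, fun ψ hψ hψc => ?_⟩
  have hGi := integrable_of_log_singularity hG hGc hGlog
  have hin : ContDiff ℝ (⊤ : ℕ∞) fun x => χ x * ψ x := χ.contDiff.mul hψ
  have hinc : HasCompactSupport fun x => χ x * ψ x := hψc.mul_left
  have hout : ContDiff ℝ (⊤ : ℕ∞) fun x => (1 - χ x) * ψ x :=
    (contDiff_const.sub χ.contDiff).mul hψ
  have houtc : HasCompactSupport fun x => (1 - χ x) * ψ x := hψc.mul_left
  have hsplit : ∀ x, planeLaplacian ψ x =
      planeLaplacian (fun x => χ x * ψ x) x + planeLaplacian (fun x => (1 - χ x) * ψ x) x := by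
    intro x
    rw [← planeLaplacian_add hin hout]
    congr 1
    ext y
    ring
  simp only [hsplit, mul_add]
  rw [integral_add]
  · congr 1
    · have h1 : χ 0 * ψ 0 = ψ 0 := by
        rw [χ.one_of_mem_closedBall (Metric.mem_closedBall_self χ.rIn_pos.le), one_mul]
      rw [← h1, ← integral_log_norm_mul_planeLaplacian hin hinc]
      have hne : ∀ᵐ x : Plane, x ≠ 0 := by simp [ae_iff]
      refine integral_congr_ae ?_
      filter_upwards [hne] with x hx
      by_cases hx2 : ‖x‖ ≤ 1 / 2
      · rw [hGlog x hx hx2]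
      · rw [planeLaplacian_eq_zero, mul_zero, mul_zero]
        have : {y : Plane | 1 / 2 < ‖y‖} ∈ 𝓝 x :=
          (isOpen_lt continuous_const continuous_norm).mem_nhds (not_le.1 hx2)
        filter_upwards [this] with y hy
        rw [χ.zero_of_le_dist (by rw [dist_zero_right]; exact le_of_lt hy), zero_mul]
    · have h1 : ∀ x, G x * planeLaplacian (fun x => (1 - χ x) * ψ x) x =
          K x * planeLaplacian (fun x => (1 - χ x) * ψ x) x := by
        intro x
        by_cases hx : ‖x‖ < 1 / 4
        · rw [planeLaplacian_eq_zero, mul_zero, mul_zero]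
          have : {y : Plane | ‖y‖ < 1 / 4} ∈ 𝓝 x :=
            (isOpen_lt continuous_norm continuous_const).mem_nhds hx
          filter_upwards [this] with y hy
          rw [χ.one_of_mem_closedBall (by
            rw [mem_closedBall_zero_iff]; exact le_of_lt hy), sub_self, zero_mul]
        · have : η x = 0 := η.zero_of_le_dist (by
            rw [dist_zero_right]
            change (1 / 8 : ℝ) ≤ ‖x‖
            linarith)
          simp [K, this]
      simp only [h1]
      rw [integral_mul_planeLaplacian hK hout houtc]
      simp only [mul_assoc]
  · exact integrable_mul_of_hasCompactSupport hGi.locallyIntegrable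
      hin.planeLaplacian.continuous hinc.planeLaplacian
  · exact integrable_mul_of_hasCompactSupport hGi.locallyIntegrable
      hout.planeLaplacian.continuous houtc.planeLaplacian

end GreenFunction

section Mollifier

variable {f F G ρ : Plane → ℝ} {ε : ℝ}

lemma contDiff_mollify (hρ : ContDiff ℝ (⊤ : ℕ∞) ρ) : ContDiff ℝ (⊤ : ℕ∞) (mollify ρ ε) :=
  contDiff_const.mul (hρ.comp (contDiff_const_smul _))

lemma hasCompactSupport_mollify (hρc : HasCompactSupport ρ) (hε : 0 < ε) :
    HasCompactSupport (mollify ρ ε) :=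
  (hρc.comp_smul (inv_ne_zero hε.ne')).mul_left

lemma mollify_neg (hρe : ∀ x, ρ (-x) = ρ x) (x : Plane) : mollify ρ ε (-x) = mollify ρ ε x := by
  simp only [mollify, smul_neg, hρe]

lemma convol_mollify (f ρ : Plane → ℝ) (hε : 0 < ε) (x : Plane) :
    convol f (mollify ρ ε) x = ∫ u, f (x - ε • u) * ρ u := by
  have h := Measure.integral_comp_inv_smul (volume : Measure Plane)
    (fun u => f (x - ε • u) * ρ u) ε
  rw [abs_of_pos (by positivity), smul_eq_mul] at h
  have h2 : ∫ u, f (x - ε • u) * ρ u =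
      (ε ^ 2)⁻¹ * ∫ y, f (x - ε • (ε⁻¹ • y)) * ρ (ε⁻¹ • y) := by
    rw [h]
    simp
    field_simp
  rw [h2, ← integral_const_mul]
  simp only [convol, mollify]
  congr 1
  ext y
  rw [smul_inv_smul₀ hε.ne', show (-((2 : ℕ) : ℤ)) = -2 from rfl, zpow_neg]
  norm_cast
  ring

lemma tendsto_integral_mul_of_bounded {l : Filter ℝ} [l.IsCountablyGenerated]
    {a : ℝ → Plane → ℝ} {M c : ℝ} (hρ : Integrable ρ)
    (ha : ∀ᶠ ε in l, Continuous (a ε)) (hM : ∀ᶠ ε in l, ∀ u, ‖a ε u‖ ≤ M)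
    (hc : ∀ u, Tendsto (fun ε => a ε u) l (𝓝 c)) :
    Tendsto (fun ε => ∫ u, a ε u * ρ u) l (𝓝 (c * ∫ u, ρ u)) := by
  rw [← integral_const_mul]
  refine tendsto_integral_filter_of_dominated_convergence (fun u => M * ‖ρ u‖) ?_ ?_ ?_ ?_
  · filter_upwards [ha] with ε h
    exact h.aestronglyMeasurable.mul hρ.aestronglyMeasurable
  · filter_upwards [hM] with ε h
    refine Eventually.of_forall fun u => ?_
    rw [norm_mul]
    exact mul_le_mul_of_nonneg_right (h u) (norm_nonneg _)
  · exact hρ.norm.const_mul M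
  · exact Eventually.of_forall fun u => (hc u).mul_const _

lemma norm_convol_mollify_le {M : ℝ} (hρ : Integrable ρ) (hε : 0 < ε) (hM : ∀ x, ‖f x‖ ≤ M)
    (x : Plane) : ‖convol f (mollify ρ ε) x‖ ≤ M * ∫ u, ‖ρ u‖ := by
  rw [convol_mollify f ρ hε, ← integral_const_mul]
  refine norm_integral_le_of_norm_le (hρ.norm.const_mul M) (Eventually.of_forall fun u => ?_)
  rw [norm_mul]
  exact mul_le_mul_of_nonneg_right (hM _) (norm_nonneg _)

lemma tendsto_convol_mollify_sub_smul (hF : Continuous F) (hFc : HasCompactSupport F)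
    (hρ : Integrable ρ) (hρi : ∫ x, ρ x = 1) (x u : Plane) :
    Tendsto (fun ε => convol F (mollify ρ ε) (x - ε • u)) (𝓝[>] 0) (𝓝 (F x)) := by
  obtain ⟨M, hM⟩ := hFc.exists_bound_of_continuous hF
  have h := tendsto_integral_mul_of_bounded (l := 𝓝[>] (0 : ℝ))
    (a := fun ε v => F (x - ε • u - ε • v)) (M := M) (c := F x) hρ
    (Eventually.of_forall fun ε => by fun_prop)
    (Eventually.of_forall fun ε v => hM _) (fun v => by
      have : Continuous fun ε : ℝ => F (x - ε • u - ε • v) := by fun_prop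
      simpa using (this.tendsto 0).mono_left nhdsWithin_le_nhds)
  rw [hρi, mul_one] at h
  refine h.congr' ?_
  filter_upwards [self_mem_nhdsWithin] with ε hε
  exact (convol_mollify F ρ hε _).symm

lemma tendsto_convol_convol_mollify (hF : Continuous F) (hFc : HasCompactSupport F)
    (hρ : ContDiff ℝ (⊤ : ℕ∞) ρ) (hρc : HasCompactSupport ρ) (hρi : ∫ x, ρ x = 1) (x : Plane) :
    Tendsto (fun ε => convol (convol F (mollify ρ ε)) (mollify ρ ε) x) (𝓝[>] 0) (𝓝 (F x)) := by
  obtain ⟨M, hM⟩ := hFc.exists_bound_of_continuous hF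
  have hρint := hρ.continuous.integrable_of_hasCompactSupport hρc (μ := volume)
  have h := tendsto_integral_mul_of_bounded (l := 𝓝[>] (0 : ℝ))
    (a := fun ε u => convol F (mollify ρ ε) (x - ε • u)) (M := M * ∫ u, ‖ρ u‖) (c := F x) hρint
    (by
      filter_upwards [self_mem_nhdsWithin] with ε hε
      exact (continuous_convol hF.locallyIntegrable (contDiff_mollify hρ).continuous
        (hasCompactSupport_mollify hρc hε)).comp (by fun_prop))
    (by
      filter_upwards [self_mem_nhdsWithin] with ε hε u
      exact norm_convol_mollify_le hρint hε hM _)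
    (tendsto_convol_mollify_sub_smul hF hFc hρint hρi x)
  rw [hρi, mul_one] at h
  refine h.congr' ?_
  filter_upwards [self_mem_nhdsWithin] with ε hε
  exact (convol_mollify _ ρ hε _).symm

lemma tendsto_integral_mul_convol_convol_mollify (hG : Integrable G) (hF : Continuous F)
    (hFc : HasCompactSupport F) (hρ : ContDiff ℝ (⊤ : ℕ∞) ρ) (hρc : HasCompactSupport ρ)
    (hρi : ∫ x, ρ x = 1) :
    Tendsto (fun ε => ∫ x, G x * convol (convol F (mollify ρ ε)) (mollify ρ ε) x) (𝓝[>] 0)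
      (𝓝 (∫ x, G x * F x)) := by
  obtain ⟨M, hM⟩ := hFc.exists_bound_of_continuous hF
  have hρint := hρ.continuous.integrable_of_hasCompactSupport hρc (μ := volume)
  refine tendsto_integral_filter_of_dominated_convergence
    (fun x => ‖G x‖ * (M * (∫ u, ‖ρ u‖) * ∫ u, ‖ρ u‖)) ?_ ?_ ?_ ?_
  · filter_upwards [self_mem_nhdsWithin] with ε hε
    have h1 := (contDiff_mollify hρ (ε := ε)).continuous
    have h2 := hasCompactSupport_mollify hρc hε
    exact hG.aestronglyMeasurable.mul (continuous_convol (continuous_convol hF.locallyIntegrable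
      h1 h2).locallyIntegrable h1 h2).aestronglyMeasurable
  · filter_upwards [self_mem_nhdsWithin] with ε hε
    refine Eventually.of_forall fun x => ?_
    rw [norm_mul]
    exact mul_le_mul_of_nonneg_left (norm_convol_mollify_le hρint hε
      (norm_convol_mollify_le hρint hε hM) x) (norm_nonneg _)
  · exact hG.norm.mul_const _
  · exact Eventually.of_forall fun x =>
      (tendsto_convol_convol_mollify hF hFc hρ hρc hρi x).const_mul _

lemma convol_mollify_of_log_singularity
    (hGlog : ∀ x : Plane, x ≠ 0 → ‖x‖ ≤ 1 / 2 → G x = -Real.log ‖x‖ / (2 * Real.pi))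
    (hρ : ContDiff ℝ (⊤ : ℕ∞) ρ) (hρc : HasCompactSupport ρ) (hρi : ∫ x, ρ x = 1) (hε : 0 < ε)
    {w : Plane} (hw : ∀ v, ρ v ≠ 0 → ε * ‖w - v‖ ≤ 1 / 2) :
    convol G (mollify ρ ε) (ε • w) =
      (-Real.log ε - convol (fun x : Plane => Real.log ‖x‖) ρ w) / (2 * Real.pi) := by
  have hρint := hρ.continuous.integrable_of_hasCompactSupport hρc (μ := volume)
  have hint : Integrable fun v : Plane => Real.log ‖w - v‖ * ρ v :=
    convolutionExistsAt_iff_integrable_swap.1 (hρc.convolutionExists_right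
      (ContinuousLinearMap.mul ℝ ℝ) locallyIntegrable_log_norm hρ.continuous w)
  have hne : ∀ᵐ v : Plane, v ≠ w := by simp [ae_iff]
  have h1 : ∫ v, G (ε • w - ε • v) * ρ v =
      ∫ v, (-Real.log ε * ρ v - Real.log ‖w - v‖ * ρ v) / (2 * Real.pi) := by
    refine integral_congr_ae ?_
    filter_upwards [hne] with v hv
    by_cases hρv : ρ v = 0
    · simp [hρv]
    have hv' : w - v ≠ 0 := sub_ne_zero.2 hv.symm
    have hn : ‖ε • (w - v)‖ = ε * ‖w - v‖ := by rw [norm_smul, Real.norm_of_nonneg hε.le]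
    rw [← smul_sub, hGlog _ (smul_ne_zero hε.ne' hv') (by rw [hn]; exact hw v hρv), hn,
      Real.log_mul hε.ne' (norm_ne_zero_iff.2 hv')]
    ring
  rw [convol_mollify G ρ hε, h1, integral_div, integral_sub (hρint.const_mul _) hint,
    integral_const_mul, hρi, mul_one]
  rfl

lemma convol_convol_mollify_zero
    (hGlog : ∀ x : Plane, x ≠ 0 → ‖x‖ ≤ 1 / 2 → G x = -Real.log ‖x‖ / (2 * Real.pi))
    (hρ : ContDiff ℝ (⊤ : ℕ∞) ρ) (hρc : HasCompactSupport ρ) (hρi : ∫ x, ρ x = 1) (hε : 0 < ε)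
    {R : ℝ} (hR : ∀ v, ρ v ≠ 0 → ‖v‖ ≤ R) (hεR : ε * (2 * R) ≤ 1 / 2) :
    convol (convol G (mollify ρ ε)) (mollify ρ ε) 0 =
      (-Real.log ε - ∫ u, convol (fun x : Plane => Real.log ‖x‖) ρ (-u) * ρ u) /
        (2 * Real.pi) := by
  have hρint := hρ.continuous.integrable_of_hasCompactSupport hρc (μ := volume)
  have hcont := continuous_convol locallyIntegrable_log_norm hρ.continuous hρc
  have hint : Integrable fun u : Plane => convol (fun x : Plane => Real.log ‖x‖) ρ (-u) * ρ u :=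
    integrable_mul_of_hasCompactSupport (hcont.comp continuous_neg).locallyIntegrable
      hρ.continuous hρc
  have h1 : ∀ u, convol G (mollify ρ ε) (0 - ε • u) * ρ u =
      (-Real.log ε * ρ u - convol (fun x : Plane => Real.log ‖x‖) ρ (-u) * ρ u) /
        (2 * Real.pi) := by
    intro u
    by_cases hu : ρ u = 0
    · simp [hu]
    rw [zero_sub, ← smul_neg, convol_mollify_of_log_singularity hGlog hρ hρc hρi hε]
    · ring
    · intro v hv
      refine (mul_le_mul_of_nonneg_left ?_ hε.le).trans hεR
      have := norm_sub_le (-u) v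
      rw [norm_neg] at this
      linarith [hR u hu, hR v hv]
  rw [convol_mollify _ ρ hε]
  simp only [h1]
  rw [integral_div, integral_sub (hρint.const_mul _) hint, integral_const_mul, hρi, mul_one]

lemma sum_integral_partialDeriv_convol_sq (hG : Integrable G) (hGc : HasCompactSupport G)
    (hF : Continuous F) (hFc : HasCompactSupport F)
    (hGF : ∀ ψ : Plane → ℝ, ContDiff ℝ (⊤ : ℕ∞) ψ → HasCompactSupport ψ →
        ∫ x, G x * planeLaplacian ψ x = -ψ 0 + ∫ x, F x * ψ x)
    (hρ : ContDiff ℝ (⊤ : ℕ∞) ρ) (hρc : HasCompactSupport ρ) (hρe : ∀ x, ρ (-x) = ρ x) :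
    ∑ i : Fin 2, ∫ x, partialDeriv i (convol G ρ) x ^ 2 =
      convol (convol G ρ) ρ 0 - ∫ x, G x * convol (convol F ρ) ρ x := by
  have hρint := hρ.continuous.integrable_of_hasCompactSupport hρc (μ := volume)
  have hg : ContDiff ℝ (⊤ : ℕ∞) (convol G ρ) := contDiff_convol hG.locallyIntegrable hρ hρc
  have hgc : HasCompactSupport (convol G ρ) := hasCompactSupport_convol hGc hρc
  have hgint := hg.continuous.integrable_of_hasCompactSupport hgc (μ := volume)
  have hlap : ∀ x, convol (planeLaplacian (convol G ρ)) ρ x =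
      planeLaplacian (convol (convol G ρ) ρ) x := by
    intro x
    rw [convol_comm _ ρ, ← planeLaplacian_convol hρint.locallyIntegrable hg hgc,
      convol_comm ρ (convol G ρ)]
  have hFG : ∫ x, F x * convol (convol G ρ) ρ x = ∫ x, G x * convol (convol F ρ) ρ x := by
    rw [← integral_convol_mul hG hρint hρe
      (continuous_convol hF.locallyIntegrable hρ.continuous hρc)
      (hasCompactSupport_convol hFc hρc), ← integral_convol_mul hgint hρint hρe hF hFc]
    simp only [mul_comm]
  rw [sum_integral_partialDeriv_sq hg hgc, integral_convol_mul hG hρint hρe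
    hg.planeLaplacian.continuous hgc.planeLaplacian]
  simp only [hlap]
  rw [hGF _ (contDiff_convol hgint.locallyIntegrable hρ hρc) (hasCompactSupport_convol hgc hρc),
    hFG]
  ring

end Mollifier

open Filter in
/-- with `G_ε = G * ρ_ε` and
`C_ε = E|∇Y_ε(0)|² = Σ_i ‖D_{x_i}G_ε‖²_{L²}`, one has
`C_ε = -(1/(2π)) log ε + O(1)`; more precisely `C_ε + (log ε)/(2π)` converges as `ε ↓ 0`. -/
theorem renormalisation_constant_asymptotics (G ρ : EuclideanSpace ℝ (Fin 2) → ℝ)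
    (hG : ContDiffOn ℝ (⊤ : ℕ∞) G {x | x ≠ 0}) (hGc : HasCompactSupport G)
    (hGe : ∀ x, G (-x) = G x)
    (hGlog : ∀ x : EuclideanSpace ℝ (Fin 2), x ≠ 0 → ‖x‖ ≤ 1 / 2 →
      G x = -Real.log ‖x‖ / (2 * Real.pi))
    (hρ : ContDiff ℝ (⊤ : ℕ∞) ρ) (hρc : HasCompactSupport ρ) (hρe : ∀ x, ρ (-x) = ρ x)
    (hρi : ∫ x, ρ x = 1) :
    ∃ c : ℝ, Tendsto (fun ε : ℝ =>
        (∑ i : Fin 2, ∫ z : EuclideanSpace ℝ (Fin 2),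
          (fderiv ℝ (convol G (mollify ρ ε)) z (EuclideanSpace.single i 1)) ^ 2)
          + Real.log ε / (2 * Real.pi))
      (nhdsWithin 0 (Set.Ioi 0)) (nhds c) := by
  have hGi := integrable_of_log_singularity hG hGc hGlog
  obtain ⟨F, hF, hFc, hGF⟩ := exists_integral_mul_planeLaplacian_eq hG hGc hGlog
  obtain ⟨R, hRpos, hR⟩ : ∃ R : ℝ, 0 < R ∧ ∀ v, ρ v ≠ 0 → ‖v‖ ≤ R := by
    obtain ⟨R, hRpos, hR⟩ := hρc.isCompact.isBounded.exists_pos_norm_le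
    exact ⟨R, hRpos, fun v hv => hR v (subset_tsupport ρ hv)⟩
  refine ⟨-(∫ u, convol (fun x : Plane => Real.log ‖x‖) ρ (-u) * ρ u) / (2 * Real.pi) -
    ∫ x, G x * F x, ?_⟩
  refine ((tendsto_integral_mul_convol_convol_mollify hGi hF hFc hρ hρc hρi).const_sub _).congr' ?_
  filter_upwards [Ioc_mem_nhdsGT (show (0 : ℝ) < 1 / (4 * R) by positivity)] with ε hε
  have hεR : ε * (2 * R) ≤ 1 / 2 := by
    have := (le_div_iff₀ (by positivity)).1 hε.2
    linarith
  have h := sum_integral_partialDeriv_convol_sq hGi hGc hF hFc hGF (contDiff_mollify hρ)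
    (hasCompactSupport_mollify hρc hε.1) (mollify_neg hρe)
  rw [convol_convol_mollify_zero hGlog hρ hρc hρi hε.1 hR hεR] at h
  simp only [partialDeriv] at h
  rw [h]
  ring
end
end
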